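/- arXiv:2206.11933 — 8 statements merged into one kernel-verified Lean document; each statement's English description precedes it below -/
import Mathlib

section
/- Let b > 1, let δ be defined from the Fibonacci word, and let f be the piecewise-affine contraction of [0,∞) with parameters v₁ = 1000, v₂ = 500, r = 1/b − 1 and ρ = (500b/(b−1))·(b(1−δ)+1). Then there exists a Cantor set C ⊂ [0,∞) such that ω_f(S₀) = C for every S₀ ≥ 0. -/
open Filter Topology

noncomputable def phiGolden : ℝ := (1 + Real.sqrt 5) / 2

noncomputable def fibWord (k : ℕ) : ℤ :=
  2 + ⌊((k : ℝ) + 1) * phiGolden⌋ - ⌊((k : ℝ) + 2) * phiGolden⌋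

noncomputable def fibDelta (b : ℝ) : ℝ :=
  1 - 1 / b + (1 / b) * (1 - 1 / b) * ∑' k : ℕ, (fibWord k : ℝ) * (1 / b) ^ k

noncomputable def rhoParam (b : ℝ) : ℝ :=
  500 * b / (b - 1) * (b * (1 - fibDelta b) + 1)

noncomputable def pwc (r v₁ v₂ ρ : ℝ) (x : ℝ) : ℝ :=
  if x < ρ then (1 + r) * x + v₁ else (1 + r) * x + v₂

def omegaLim (g : ℝ → ℝ) (x : ℝ) : Set ℝ :=
  {p : ℝ | ∃ n : ℕ → ℕ, StrictMono n ∧ Tendsto (fun k => g^[n k] x) atTop (𝓝 p)}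

def IsCantorSet (C : Set ℝ) : Prop :=
  C.Nonempty ∧ IsCompact C ∧ Perfect C ∧ IsNowhereDense C

def IsPeriodicSeq (a : ℕ → ℝ) : Prop := ∃ n ≥ 1, ∀ i, a (i + n) = a i

def AsymptoticTo (s a : ℕ → ℝ) : Prop :=
  Tendsto (fun n => |s n - a n|) atTop (𝓝 0)

open scoped Classical in
noncomputable def visitCount (g : ℝ → ℝ) (x : ℝ) (J : Set ℝ) (N : ℕ) : ℕ :=
  ((Finset.range N).filter (fun n => g^[n] x ∈ J)).card

noncomputable def alphaRot : ℝ := (3 - Real.sqrt 5) / 2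

noncomputable def Trot (x : ℝ) : ℝ :=
  if x < 1 - alphaRot then x + alphaRot else x + alphaRot - 1

noncomputable def gmap (b : ℝ) (x : ℝ) : ℝ :=
  if x < b * (1 - fibDelta b) then x / b + fibDelta b else x / b + fibDelta b - 1

noncomputable def fmap (b : ℝ) (x : ℝ) : ℝ :=
  if x < rhoParam b then x / b + 1000 else x / b + 500

noncomputable def Kset (b : ℝ) : Set ℝ :=
  Set.Icc (500 * b / (b - 1) * (2 - fibDelta b))
    (500 * b / (b - 1) * (3 - fibDelta b - 1 / b))


lemma dens {a : ℝ} (ha : Irrational a) {s t : ℝ} (h : s < t) (N : ℕ) :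
    ∃ n ≥ N, ∃ m : ℤ, s < n * a + m ∧ n * a + m < t := by
  have h1 : DenseRange (fun n : ℕ => n • (a : AddCircle (1:ℝ))) := by
    rw [← denseRange_zsmul_iff_nsmul, AddCircle.denseRange_zsmul_coe_iff]
    simpa using ha
  have ho : IsOpen ((fun x : ℝ => (x : AddCircle (1:ℝ))) '' Set.Ioo (s - N * a) (t - N * a)) :=
    QuotientAddGroup.isOpenMap_coe _ isOpen_Ioo
  obtain ⟨n, y, hy, hn⟩ := h1.exists_mem_open ho
    ⟨_, (s + t) / 2 - N * a, ⟨by linarith, by linarith⟩, rfl⟩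
  have hn' : ((y - n * a : ℝ) : AddCircle (1:ℝ)) = 0 := by
    simp only at hn
    rw [AddCircle.coe_sub, hn, ← nsmul_eq_mul]
    simp
  rw [AddCircle.coe_eq_zero_iff] at hn'
  obtain ⟨m, hm⟩ := hn'
  simp at hm
  refine ⟨n + N, by omega, m, ?_, ?_⟩
  · push_cast; rw [hm]; linarith [hy.1]
  · push_cast; rw [hm]; linarith [hy.2]

noncomputable def FF (l a t : ℝ) : ℝ := ∑' k : ℕ, l ^ k * Int.fract (t - (k + 1) * a)
noncomputable def YY (l a t : ℝ) : ℝ := t + (1 - l) * (FF l a 0 - FF l a t)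

section
variable {l a : ℝ}

lemma summF (hl0 : 0 < l) (hl1 : l < 1) (t : ℝ) :
    Summable (fun k : ℕ => l ^ k * Int.fract (t - (k + 1) * a)) := by
  refine Summable.of_nonneg_of_le (fun k => ?_) (fun k => ?_)
    (summable_geometric_of_lt_one hl0.le hl1)
  · have := Int.fract_nonneg (t - (k + 1) * a); positivity
  · have := (Int.fract_lt_one (t - (k + 1) * a)).le
    have h2 : 0 < l ^ k := by positivity
    nlinarith

lemma FF_shift (hl0 : 0 < l) (hl1 : l < 1) (t : ℝ) :
    FF l a (t + a) = Int.fract t + l * FF l a t := by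
  unfold FF
  rw [(summF hl0 hl1 (t + a)).tsum_eq_zero_add, ← tsum_mul_left]
  congr 1
  · simp
  · congr 1; ext k; rw [pow_succ]; push_cast
    rw [show t + a - ((k:ℝ) + 1 + 1) * a = t - (k + 1) * a by ring]; ring

lemma FF_int (t : ℝ) (m : ℤ) : FF l a (t + m) = FF l a t := by
  unfold FF
  congr 1; ext k
  rw [show t + m - ((k:ℝ) + 1) * a = t - (k + 1) * a + m by ring, Int.fract_add_intCast]

lemma YY_int (t : ℝ) (m : ℤ) : YY l a (t + m) = YY l a t + m := by
  unfold YY; rw [FF_int]; ring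

lemma YY_zero : YY l a 0 = 0 := by simp [YY]

lemma YY_intCast (m : ℤ) : YY l a m = m := by
  have := YY_int (l := l) (a := a) 0 m
  simpa [YY_zero] using this

lemma YY_shift (hl0 : 0 < l) (hl1 : l < 1) (t : ℝ) :
    YY l a (t + a) = l * YY l a t + (a + (1 - l) ^ 2 * FF l a 0) + (1 - l) * ⌊t⌋ := by
  unfold YY; rw [FF_shift hl0 hl1, Int.fract]; ring

lemma YY_jump (hl0 : 0 < l) (hl1 : l < 1) {s t : ℝ} (h : s ≤ t) (k : ℕ) :
    (1 - l) * (l ^ k * (⌊t - (k + 1) * a⌋ - ⌊s - (k + 1) * a⌋ : ℝ)) ≤ YY l a t - YY l a s := by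
  have hl : (1 - l) ≠ 0 := by linarith
  have hs : HasSum (fun k : ℕ => l ^ k * (⌊t - (k + 1) * a⌋ - ⌊s - (k + 1) * a⌋ : ℝ))
      ((t - s) * (1 - l)⁻¹ + FF l a s - FF l a t) := by
    convert ((((hasSum_geometric_of_lt_one hl0.le hl1).mul_left (t - s)).add
      (summF (a := a) hl0 hl1 s).hasSum).sub (summF (a := a) hl0 hl1 t).hasSum) using 1
    · rfl
    · funext k; simp only [Int.fract]; ring
    · rfl
  have h1 := le_hasSum hs k (fun j _ => by
    have : (⌊s - (j + 1) * a⌋ : ℝ) ≤ ⌊t - (j + 1) * a⌋ := by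
      exact_mod_cast Int.floor_mono (by linarith)
    have h2 : 0 < l ^ j := by positivity
    exact mul_nonneg h2.le (by linarith))
  calc _ ≤ (1 - l) * ((t - s) * (1 - l)⁻¹ + FF l a s - FF l a t) :=
        mul_le_mul_of_nonneg_left h1 (by linarith)
    _ = _ := by unfold YY; field_simp; ring

/-- every interval contains a jump -/
lemma YY_gap (hl0 : 0 < l) (hl1 : l < 1) (ha : Irrational a) {s t : ℝ} (h : s < t) :
    ∃ u η : ℝ, s < u ∧ u < t ∧ 0 < η ∧ ∀ v < u, YY l a v ≤ YY l a u - η := by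
  obtain ⟨n, hn, m, h1, h2⟩ := dens ha h 1
  obtain ⟨k, rfl⟩ : ∃ k, n = k + 1 := ⟨n - 1, by omega⟩
  push_cast at h1 h2
  refine ⟨_, (1 - l) * l ^ k, h1, h2, mul_pos (by linarith) (by positivity), fun v hv => ?_⟩
  have := YY_jump (a := a) hl0 hl1 hv.le k
  have e1 : ⌊((k:ℝ) + 1) * a + m - (k + 1) * a⌋ = m := by simp
  have e2 : (⌊v - (k + 1) * a⌋ : ℝ) ≤ m - 1 := by
    have : ⌊v - (k + 1) * a⌋ < m := by rw [Int.floor_lt]; linarith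
    have : ⌊v - (k + 1) * a⌋ ≤ m - 1 := by omega
    exact_mod_cast this
  rw [e1] at this
  have h3 : 0 < (1 - l) * l ^ k := mul_pos (by linarith) (by positivity)
  nlinarith

lemma YY_strictMono (hl0 : 0 < l) (hl1 : l < 1) (ha : Irrational a) : StrictMono (YY l a) := by
  have hm : Monotone (YY l a) := fun s t h => by
    have := YY_jump (a := a) hl0 hl1 h 0
    have h2 : (⌊s - (((0:ℕ):ℝ) + 1) * a⌋ : ℝ) ≤ ⌊t - (((0:ℕ):ℝ) + 1) * a⌋ := by
      exact_mod_cast Int.floor_mono (by linarith)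
    have : 0 ≤ (1 - l) * (l ^ 0 * (⌊t - (((0:ℕ):ℝ) + 1) * a⌋ - ⌊s - (((0:ℕ):ℝ) + 1) * a⌋ : ℝ)) :=
      mul_nonneg (by linarith) (mul_nonneg (by positivity) (by linarith))
    linarith
  intro s t h
  obtain ⟨u, η, h1, h2, h3, h4⟩ := YY_gap hl0 hl1 ha h
  have := h4 s h1
  have := hm h2.le
  linarith

lemma YY_tendsto (hl0 : 0 < l) (hl1 : l < 1) {t : ℝ} {F : Filter ℝ}
    (hF : ∀ k : ℕ, Tendsto (fun s => Int.fract (s - (k + 1) * a)) F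
      (𝓝 (Int.fract (t - (k + 1) * a)))) (hF' : F ≤ 𝓝 t) :
    Tendsto (YY l a) F (𝓝 (YY l a t)) := by
  unfold YY
  refine (tendsto_id.mono_right hF').add (tendsto_const_nhds.mul (tendsto_const_nhds.sub ?_))
  unfold FF
  refine tendsto_tsum_of_dominated_convergence (summable_geometric_of_lt_one hl0.le hl1)
    (fun k => tendsto_const_nhds.mul (hF k)) (Eventually.of_forall fun s k => ?_)
  have := (Int.fract_lt_one (s - (k + 1) * a)).le
  have h1 := Int.fract_nonneg (s - (k + 1) * a)
  have h2 : 0 < l ^ k := by positivity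
  rw [Real.norm_eq_abs, abs_of_nonneg (by positivity)]
  nlinarith

lemma fract_right (x : ℝ) : Tendsto Int.fract (𝓝[≥] x) (𝓝 (Int.fract x)) := by
  have := (continuousOn_fract (α := ℝ) ⌊x⌋) x ⟨Int.floor_le x, Int.lt_floor_add_one x⟩
  refine this.mono_left ?_
  rw [nhdsWithin_le_iff]
  refine mem_of_superset (inter_mem_nhdsWithin _ (Iio_mem_nhds (Int.lt_floor_add_one x))) ?_
  rintro y ⟨h1, h2⟩
  exact ⟨(Int.floor_le x).trans h1, h2⟩

lemma YY_right (hl0 : 0 < l) (hl1 : l < 1) (t : ℝ) :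
    Tendsto (YY l a) (𝓝[>] t) (𝓝 (YY l a t)) := by
  refine YY_tendsto hl0 hl1 (fun k => (fract_right _).comp ?_) nhdsWithin_le_nhds
  refine tendsto_nhdsWithin_of_tendsto_nhds_of_eventually_within _ ?_ ?_
  · exact ((continuous_id.sub continuous_const).tendsto t).mono_left nhdsWithin_le_nhds
  · filter_upwards [self_mem_nhdsWithin] with s hs
    have : t < s := hs
    simp; linarith

lemma YY_left_int (hl0 : 0 < l) (hl1 : l < 1) (ha : Irrational a) (m : ℤ) :
    Tendsto (YY l a) (𝓝[<] (m : ℝ)) (𝓝 (YY l a m)) := by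
  refine YY_tendsto hl0 hl1 (fun k => ?_) nhdsWithin_le_nhds
  have hirr : Irrational ((m : ℝ) - (k + 1) * a) := by
    have := (ha.natCast_mul (m := k + 1) (by omega)).intCast_sub m
    exact_mod_cast this
  have := continuousAt_fract (x := (m : ℝ) - (k + 1) * a) (hirr.ne_int _)
  exact (this.tendsto.comp ((continuous_id.sub continuous_const).tendsto (m : ℝ))).mono_left
    nhdsWithin_le_nhds

noncomputable def GG (l d x : ℝ) : ℝ := l * x + d + (1 - l) * ⌊x⌋

def PP (l a z t : ℝ) : Prop := (∀ s < t, YY l a s ≤ z) ∧ z ≤ YY l a t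

lemma GG_mono (hl0 : 0 < l) (hl1 : l < 1) (d : ℝ) : Monotone (GG l d) := by
  intro x y h
  unfold GG
  have : (⌊x⌋ : ℝ) ≤ ⌊y⌋ := by exact_mod_cast Int.floor_mono h
  nlinarith

lemma YY_floor (hl0 : 0 < l) (hl1 : l < 1) (ha : Irrational a) (t : ℝ) :
    ⌊YY l a t⌋ = ⌊t⌋ := by
  have hm := YY_strictMono hl0 hl1 ha
  rw [Int.floor_eq_iff]
  constructor
  · rw [← YY_intCast (l := l) (a := a)]; exact hm.monotone (Int.floor_le t)
  · have := hm (Int.lt_floor_add_one t)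
    have e := YY_intCast (l := l) (a := a) (⌊t⌋ + 1)
    push_cast at e
    linarith

lemma GG_YY (hl0 : 0 < l) (hl1 : l < 1) (ha : Irrational a) (t : ℝ) :
    GG l (a + (1 - l) ^ 2 * FF l a 0) (YY l a t) = YY l a (t + a) := by
  rw [YY_shift hl0 hl1, GG, YY_floor hl0 hl1 ha]

lemma PP_floor (hl0 : 0 < l) (hl1 : l < 1) (ha : Irrational a) {z t : ℝ} (h : PP l a z t) :
    ⌊z⌋ = ⌊t⌋ := by
  obtain ⟨h1, h2⟩ := h
  apply le_antisymm
  · rw [← YY_floor hl0 hl1 ha t]; exact Int.floor_mono h2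
  · rw [Int.le_floor]
    rcases (Int.floor_le t).lt_or_eq with h | h
    · have := h1 _ h; rwa [YY_intCast] at this
    · have := YY_left_int hl0 hl1 ha ⌊t⌋
      rw [YY_intCast] at this
      refine le_of_tendsto this ?_
      filter_upwards [self_mem_nhdsWithin] with s hs
      exact h1 s (lt_of_lt_of_eq hs h)

lemma PP_step (hl0 : 0 < l) (hl1 : l < 1) (ha : Irrational a) {z t : ℝ} (h : PP l a z t) :
    PP l a (GG l (a + (1 - l) ^ 2 * FF l a 0) z) (t + a) := by
  refine ⟨fun s hs => ?_, ?_⟩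
  · have := GG_mono hl0 hl1 (a + (1 - l) ^ 2 * FF l a 0) (h.1 (s - a) (by linarith))
    rwa [GG_YY hl0 hl1 ha, sub_add_cancel] at this
  · rw [← GG_YY hl0 hl1 ha]
    exact GG_mono hl0 hl1 _ h.2

lemma PP_exists (hl0 : 0 < l) (hl1 : l < 1) (ha : Irrational a) (z : ℝ) : ∃ t, PP l a z t := by
  have hm := YY_strictMono hl0 hl1 ha
  set S := {s | YY l a s ≤ z} with hS
  have hb : BddAbove S := by
    refine ⟨((⌊z⌋ + 1 : ℤ) : ℝ), fun s hs => ?_⟩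
    have h1 : YY l a s ≤ z := hs
    by_contra h
    have := hm (not_le.1 h)
    rw [YY_intCast] at this
    have := Int.lt_floor_add_one z
    push_cast at *
    linarith
  have hn : S.Nonempty := ⟨(⌊z⌋ : ℝ), by
    change YY l a _ ≤ z
    rw [YY_intCast]; exact Int.floor_le z⟩
  refine ⟨sSup S, fun s hs => ?_, ?_⟩
  · obtain ⟨s', h1, h2⟩ := exists_lt_of_lt_csSup hn hs
    exact (hm h2).le.trans h1
  · refine ge_of_tendsto (YY_right hl0 hl1 (sSup S)) ?_
    filter_upwards [self_mem_nhdsWithin] with s hs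
    by_contra h
    exact absurd (le_csSup hb (show s ∈ S from (not_le.1 h).le)) (not_le.2 hs)

lemma asymp (hl0 : 0 < l) (hl1 : l < 1) (ha : Irrational a) {z t : ℝ} (h : PP l a z t) (n : ℕ) :
    PP l a ((GG l (a + (1 - l) ^ 2 * FF l a 0))^[n] z) (t + n * a) ∧
    |(GG l (a + (1 - l) ^ 2 * FF l a 0))^[n] z - YY l a (t + n * a)|
      = l ^ n * |z - YY l a t| := by
  induction n with
  | zero => simpa using h
  | succ n ih =>
    rw [Function.iterate_succ_apply']
    set w := (GG l (a + (1 - l) ^ 2 * FF l a 0))^[n] z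
    rw [show t + ((n + 1 : ℕ) : ℝ) * a = t + n * a + a by push_cast; ring]
    refine ⟨PP_step hl0 hl1 ha ih.1, ?_⟩
    rw [← GG_YY hl0 hl1 ha, GG, GG, YY_floor hl0 hl1 ha, PP_floor hl0 hl1 ha ih.1,
      show l ^ (n + 1) * |z - YY l a t| = l * (l ^ n * |z - YY l a t|) by ring, ← ih.2, ← abs_of_pos hl0, ← abs_mul, abs_of_pos hl0]
    congr 1; ring

lemma asymp_fract (hl0 : 0 < l) (hl1 : l < 1) (ha : Irrational a) (z : ℝ) :
    ∃ t, ∀ n : ℕ, |Int.fract ((GG l (a + (1 - l) ^ 2 * FF l a 0))^[n] z)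
      - YY l a (Int.fract (t + n * a))| = l ^ n * |z - YY l a t| := by
  obtain ⟨t, ht⟩ := PP_exists hl0 hl1 ha z
  refine ⟨t, fun n => ?_⟩
  obtain ⟨h1, h2⟩ := asymp hl0 hl1 ha ht n
  rw [← h2, Int.fract, PP_floor hl0 hl1 ha h1]
  have := YY_int (l := l) (a := a) (Int.fract (t + n * a)) ⌊t + n * a⌋
  rw [Int.fract_add_floor] at this
  rw [this]; congr 1; ring
end

lemma cantor_of {W : ℝ → ℝ} (hm : StrictMono W) (hr : ∀ t, Tendsto W (𝓝[>] t) (𝓝 (W t)))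
    (hg : ∀ s t, s < t → ∃ u η : ℝ, s < u ∧ u < t ∧ 0 < η ∧ ∀ v < u, W v ≤ W u - η) :
    IsCantorSet (closure (W '' Set.Ico 0 1)) := by
  have hsub : closure (W '' Set.Ico 0 1) ⊆ Set.Icc (W 0) (W 1) := by
    refine closure_minimal ?_ isClosed_Icc
    rintro _ ⟨u, hu, rfl⟩
    exact ⟨hm.monotone hu.1, hm.monotone hu.2.le⟩
  refine ⟨⟨W 0, subset_closure ⟨0, by simp, rfl⟩⟩, isCompact_Icc.of_isClosed_subset
    isClosed_closure hsub, Preperfect.perfect_closure ?_, ?_⟩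
  · rw [preperfect_iff_nhds]
    rintro _ ⟨u, hu, rfl⟩ U hU
    have h1 : ∀ᶠ v in 𝓝[>] u, W v ∈ U := (hr u) hU
    have h2 : ∀ᶠ v in 𝓝[>] u, v < 1 := mem_nhdsWithin_of_mem_nhds (Iio_mem_nhds hu.2)
    obtain ⟨v, hv1, hv2, hv3⟩ := (h1.and (h2.and self_mem_nhdsWithin)).exists
    have hv3 : u < v := hv3
    exact ⟨W v, ⟨hv1, v, ⟨by linarith [hu.1], hv2⟩, rfl⟩, (hm hv3).ne'⟩
  · rw [IsNowhereDense, closure_closure]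
    by_contra hne
    obtain ⟨p, hp⟩ := Set.nonempty_iff_ne_empty.2 hne
    obtain ⟨ε, hε, hb⟩ := Metric.isOpen_iff.1 isOpen_interior p hp
    have hb' : Set.Ioo (p - ε) (p + ε) ⊆ closure (W '' Set.Ico 0 1) := by
      rw [← Real.ball_eq_Ioo]; exact hb.trans interior_subset
    have key : ∀ x y, x < y → p - ε ≤ x → y ≤ p + ε → ∃ u ∈ Set.Ico (0:ℝ) 1, x < W u ∧ W u < y := by
      intro x y hxy h1 h2
      have : (x + y) / 2 ∈ closure (W '' Set.Ico 0 1) := hb' ⟨by linarith, by linarith⟩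
      obtain ⟨_, ⟨h3, h4⟩, u, hu, rfl⟩ := mem_closure_iff.1 this (Set.Ioo x y) isOpen_Ioo
        ⟨by linarith, by linarith⟩
      exact ⟨u, hu, h3, h4⟩
    obtain ⟨s, hs, hs1, hs2⟩ := key (p - ε) p (by linarith) le_rfl (by linarith)
    obtain ⟨t, ht, ht1, ht2⟩ := key p (p + ε) (by linarith) (by linarith) le_rfl
    have hst : s < t := hm.lt_iff_lt.1 (hs2.trans ht1)
    obtain ⟨u, η, hu1, hu2, hη, hgap⟩ := hg s t hst
    have := hgap s hu1
    have := hm hu2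
    obtain ⟨v, hv, hv1, hv2⟩ := key (W u - η) (W u) (by linarith) (by linarith) (by linarith)
    have := hgap v (hm.lt_iff_lt.1 hv2)
    linarith

lemma omega_of {W : ℝ → ℝ} (hr : ∀ t, Tendsto W (𝓝[>] t) (𝓝 (W t)))
    {a : ℝ} (ha : Irrational a) {t : ℝ} {x : ℕ → ℝ} {N : ℕ}
    (hx : Tendsto (fun n => x (n + N) - W (Int.fract (t + n * a))) atTop (𝓝 0)) (p : ℝ) :
    (∃ n : ℕ → ℕ, StrictMono n ∧ Tendsto (fun k => x (n k)) atTop (𝓝 p)) ↔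
      p ∈ closure (W '' Set.Ico 0 1) := by
  have hmem : ∀ n : ℕ, W (Int.fract (t + n * a)) ∈ W '' Set.Ico 0 1 := fun n =>
    ⟨_, ⟨Int.fract_nonneg _, Int.fract_lt_one _⟩, rfl⟩
  constructor
  · rintro ⟨n, hn, hp⟩
    have h1 : Tendsto (fun k => n (k + N) - N) atTop atTop :=
      tendsto_atTop_mono (fun k => by have := hn.le_apply (x := k + N); simp only [id]; omega) tendsto_id
    have h2 := (tendsto_add_atTop_iff_nat N).2 hp
    have h3 := h2.sub (hx.comp h1)
    rw [sub_zero] at h3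
    refine mem_closure_of_tendsto h3 (Eventually.of_forall fun k => ?_)
    have e : n (k + N) - N + N = n (k + N) := by
      have := hn.le_apply (x := k + N); omega
    have := hmem (n (k + N) - N)
    simpa [Function.comp, e] using this
  · intro hp
    have : MapClusterPt p atTop x := by
      rw [mapClusterPt_iff_frequently]
      intro s hs
      rw [frequently_atTop]
      intro M
      obtain ⟨ε, hε, hb⟩ := Metric.mem_nhds_iff.1 hs
      obtain ⟨_, ⟨u, hu, rfl⟩, hu'⟩ := Metric.mem_closure_iff.1 hp (ε / 3) (by linarith)
      have e1 : ∀ᶠ v in 𝓝[>] u, dist (W v) (W u) < ε / 3 :=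
        (Metric.tendsto_nhds.1 (hr u)) _ (by linarith)
      have e2 : ∀ᶠ v in 𝓝[>] u, v < 1 := mem_nhdsWithin_of_mem_nhds (Iio_mem_nhds hu.2)
      obtain ⟨u', hu1, hu2⟩ := (mem_nhdsGT_iff_exists_Ioo_subset).1 (e1.and e2)
      obtain ⟨K, hK⟩ := eventually_atTop.1 ((Metric.tendsto_nhds.1 hx) (ε / 3) (by linarith))
      have hu1 : u < u' := hu1
      obtain ⟨n, hn, m, h1, h2⟩ := dens ha (show u - t < u' - t by linarith) (max K M)
      have hin := hu2 (show t + n * a + m ∈ Set.Ioo u u' from ⟨by linarith, by linarith⟩)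
      have hfr : Int.fract (t + n * a) = t + n * a + m := by
        rw [← Int.fract_add_intCast _ m, Int.fract_eq_self]
        exact ⟨by linarith [hu.1], hin.2⟩
      refine ⟨n + N, by have := le_max_right K M; omega, hb ?_⟩
      have h3 := hK n (by have := le_max_left K M; omega)
      have h4 := hin.1
      rw [hfr] at h3
      rw [Metric.mem_ball]
      rw [Real.dist_eq, abs_lt] at *
      constructor <;> linarith [h3.1, h3.2, h4.1, h4.2, hu'.1, hu'.2]
    obtain ⟨ψ, h1, h2⟩ := this.tendsto_subseq
    exact ⟨ψ, h1, h2⟩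

lemma delta_eq {b : ℝ} (hb : 1 < b) :
    fibDelta b = (2 - phiGolden) + (1 - 1 / b) ^ 2 * FF (1 / b) (2 - phiGolden) 0 := by
  have hl0 : 0 < 1 / b := by positivity
  have hl1 : 1 / b < 1 := by rw [div_lt_one (by linarith)]; exact hb
  unfold fibDelta
  set l := 1 / b
  set a := 2 - phiGolden with ha
  have hphi : 0 < a ∧ a < 1 := by
    have h1 : Real.sqrt 5 < 3 := by rw [Real.sqrt_lt' (by norm_num)]; norm_num
    have h2 : 1 < Real.sqrt 5 := by rw [Real.lt_sqrt (by norm_num)]; norm_num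
    constructor <;> rw [ha, phiGolden] <;> linarith
  have hF : ∀ k : ℕ, Int.fract (((k:ℝ) + 1) * phiGolden) = Int.fract (0 - (k + 1) * a) := by
    intro k
    rw [show ((k:ℝ) + 1) * phiGolden = 0 - (k + 1) * a + ((2 * (k + 1) : ℤ) : ℝ) by
      rw [ha]; push_cast; ring, Int.fract_add_intCast]
  have hw : ∀ k : ℕ, (fibWord k : ℝ) = a + Int.fract (0 - (((k + 1 : ℕ) : ℝ) + 1) * a)
      - Int.fract (0 - (k + 1) * a) := by
    intro k
    rw [← hF, ← hF, fibWord, Int.fract, Int.fract, ha]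
    push_cast
    rw [show (k:ℝ) + 1 + 1 = k + 2 by ring]
    ring
  have hS := summF (a := a) hl0 hl1 0
  have h0 : Int.fract (0 - (((0 : ℕ) : ℝ) + 1) * a) = 1 - a := by
    rw [Int.fract_eq_iff]
    exact ⟨by linarith, by linarith, -1, by push_cast; ring⟩
  have hS1 := ((hasSum_nat_add_iff' 1).2 hS.hasSum)
  have hsum : HasSum (fun k : ℕ => l * ((fibWord k : ℝ) * l ^ k))
      (l * a * (1 - l)⁻¹ + (FF l a 0 - (1 - a)) - l * FF l a 0) := by
    convert ((((hasSum_geometric_of_lt_one hl0.le hl1).mul_left (l * a)).add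
      hS1).sub (hS.hasSum.mul_left l)) using 1
    · rfl
    · funext k; rw [hw]; ring
    · rw [Finset.sum_range_one, h0]; simp [FF]
  have := hsum.tsum_eq
  rw [tsum_mul_left] at this
  have hl : 1 - l ≠ 0 := by linarith
  calc _ = 1 - l + (1 - l) * (l * ∑' k : ℕ, (fibWord k : ℝ) * l ^ k) := by ring
    _ = _ := by rw [this]; field_simp; ring

theorem stmt1 (b : ℝ) (hb : 1 < b) :
    ∃ C : Set ℝ, IsCantorSet C ∧ C ⊆ Set.Ici 0 ∧
      ∀ S₀ : ℝ, 0 ≤ S₀ →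
        omegaLim (pwc (1 / b - 1) 1000 500 (rhoParam b)) S₀ = C := by
  have hl0 : 0 < 1 / b := by positivity
  have hl1 : 1 / b < 1 := by rw [div_lt_one (by linarith)]; exact hb
  have hdl := delta_eq hb
  have hb' : b = 1 / (1 / b) := by simp
  have hirr : Irrational (2 - phiGolden) := by
    have := Real.goldenRatio_irrational.intCast_sub 2
    exact_mod_cast this
  have hphi : 0 < 2 - phiGolden ∧ 2 - phiGolden < 1 := by
    have h1 : Real.sqrt 5 < 3 := by rw [Real.sqrt_lt' (by norm_num)]; norm_num
    have h2 : 1 < Real.sqrt 5 := by rw [Real.lt_sqrt (by norm_num)]; norm_num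
    constructor <;> rw [phiGolden] <;> linarith
  set d := fibDelta b with hd
  set l := 1 / b with hl
  set a := 2 - phiGolden with ha
  have hm := YY_strictMono hl0 hl1 hirr
  have hY1 : YY l a 1 = 1 := by simpa using YY_intCast (l := l) (a := a) 1
  have hda : YY l a a = d := by
    have := YY_shift (a := a) hl0 hl1 0
    rw [YY_zero, ← hdl] at this
    simpa using this
  have hd0 : 0 < d := by
    have := hm hphi.1
    rwa [YY_zero, hda] at this
  have hd1 : d < 1 := by
    have := hm hphi.2
    rwa [hY1, hda] at this
  have hld : 1 < l + d := by
    have h1 := YY_shift (a := a) hl0 hl1 (1 - a)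
    rw [sub_add_cancel, hY1, ← hdl, Int.floor_eq_zero_iff.2 ⟨by linarith, by linarith⟩] at h1
    have h2 : YY l a (1 - a) < 1 := by
      have := hm (show 1 - a < 1 by linarith)
      rwa [hY1] at this
    push_cast at h1
    nlinarith
  set c := 500 / (1 - l) * (2 - d) with hc
  set f := pwc (l - 1) 1000 500 (rhoParam b) with hf
  have hll : 1 - l ≠ 0 := by linarith
  have hrho : rhoParam b = 500 * ((1 - d) / l) + c := by
    rw [rhoParam, ← hd, hc]
    have hb1 : b - 1 ≠ 0 := by linarith
    have hb0 : b ≠ 0 := by linarith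
    rw [hl]; field_simp; ring
  have hcc : l * c + 1000 = 500 * d + c := by
    rw [hc]; field_simp; ring
  have hfz : ∀ z, f (500 * z + c) =
      if l * z + d < 1 then 500 * (l * z + d) + c else 500 * (l * z + d - 1) + c := by
    intro z
    have : (500 * z + c < rhoParam b) ↔ l * z + d < 1 := by
      rw [hrho, add_lt_add_iff_right, mul_lt_mul_iff_right₀ (by norm_num), lt_div_iff₀ hl0]
      constructor <;> intro h <;> linarith
    rw [hf, pwc]
    simp only [this]
    split_ifs <;> linarith
  have hfr : ∀ z, 0 ≤ z → z < 1 → f (500 * z + c) = 500 * Int.fract (GG l d z) + c := by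
    intro z h0 h1
    have e : GG l d z = l * z + d := by
      rw [GG, Int.floor_eq_zero_iff.2 ⟨h0, h1⟩]; simp
    rw [hfz, e]
    split_ifs with h
    · rw [Int.fract_eq_self.2 ⟨by positivity, h⟩]
    · congr 2
      symm
      rw [Int.fract_eq_iff]
      exact ⟨by linarith, by nlinarith, 1, by push_cast; ring⟩
  have hit : ∀ z, 0 ≤ z → z < 1 → ∀ n, f^[n] (500 * z + c) = 500 * Int.fract ((GG l d)^[n] z) + c := by
    intro z h0 h1 n
    induction n with
    | zero => simp [Int.fract_eq_self.2 ⟨h0, h1⟩]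
    | succ n ih =>
      rw [Function.iterate_succ_apply', Function.iterate_succ_apply', ih,
        hfr _ (Int.fract_nonneg _) (Int.fract_lt_one _)]
      set w := (GG l d)^[n] z
      congr 2
      rw [← Int.fract_add_intCast _ ⌊w⌋]
      congr 1
      rw [GG, GG, Int.floor_fract, Int.fract]; push_cast; ring
  have hlow : ∀ k : ℕ, ∀ z, z < 1 → -(k * d) ≤ z →
      ∃ N w, 0 ≤ w ∧ w < 1 ∧ f^[N] (500 * z + c) = 500 * w + c := by
    intro k
    induction k with
    | zero => intro z h1 h2; exact ⟨0, z, by simpa using h2, h1, rfl⟩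
    | succ k ih =>
      intro z h1 h2
      rcases le_or_gt 0 z with h | h
      · exact ⟨0, z, h, h1, rfl⟩
      · push_cast at h2
        obtain ⟨N, w, hw⟩ := ih (l * z + d) (by nlinarith) (by nlinarith)
        refine ⟨N + 1, w, hw.1, hw.2.1, ?_⟩
        rw [Function.iterate_succ_apply, hfz, if_pos (by nlinarith), hw.2.2]
  have hhigh : ∀ k : ℕ, ∀ z, 0 ≤ z → z ≤ k * (1 - d) →
      ∃ N w, 0 ≤ w ∧ w < 1 ∧ f^[N] (500 * z + c) = 500 * w + c := by
    intro k
    induction k with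
    | zero =>
      intro z h1 h2
      exact ⟨0, z, h1, by push_cast at h2; linarith, rfl⟩
    | succ k ih =>
      intro z h1 h2
      rcases lt_or_ge z 1 with h | h
      · exact ⟨0, z, h1, h, rfl⟩
      · push_cast at h2
        obtain ⟨N, w, hw⟩ := ih (l * z + d - 1) (by nlinarith) (by nlinarith)
        refine ⟨N + 1, w, hw.1, hw.2.1, ?_⟩
        rw [Function.iterate_succ_apply, hfz, if_neg (by nlinarith), hw.2.2]
  have hev : ∀ x, ∃ N w, 0 ≤ w ∧ w < 1 ∧ f^[N] x = 500 * w + c := by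
    intro x
    have hx : x = 500 * ((x - c) / 500) + c := by ring
    rw [hx]
    set z := (x - c) / 500
    rcases lt_or_ge z 0 with h | h
    · obtain ⟨k, hk⟩ := exists_nat_ge (-z / d)
      rw [div_le_iff₀ hd0] at hk
      exact hlow k z (by linarith) (by linarith)
    · obtain ⟨k, hk⟩ := exists_nat_ge (z / (1 - d))
      rw [div_le_iff₀ (by linarith)] at hk
      exact hhigh k z h hk
  set W : ℝ → ℝ := fun t => 500 * YY l a t + c with hW
  have hWm : StrictMono W := fun s t h => by
    have := hm h
    simp only [hW]; linarith
  have hWr : ∀ t, Tendsto W (𝓝[>] t) (𝓝 (W t)) := fun t =>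
    ((YY_right hl0 hl1 t).const_mul 500).add_const c
  refine ⟨closure (W '' Set.Ico 0 1), cantor_of hWm hWr ?_, ?_, ?_⟩
  · intro s t h
    obtain ⟨u, η, h1, h2, h3, h4⟩ := YY_gap hl0 hl1 hirr h
    refine ⟨u, 500 * η, h1, h2, by positivity, fun v hv => ?_⟩
    have := h4 v hv
    simp only [hW]; linarith
  · refine closure_minimal ?_ isClosed_Ici
    rintro _ ⟨u, hu, rfl⟩
    have h1 := hm.monotone hu.1
    rw [YY_zero] at h1
    have h2 : 0 ≤ c := mul_nonneg (div_nonneg (by norm_num) (by linarith)) (by linarith)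
    simp only [hW, Set.mem_Ici]; linarith
  · intro x _
    obtain ⟨N, w, hw0, hw1, hN⟩ := hev x
    obtain ⟨t, ht⟩ := asymp_fract hl0 hl1 hirr w
    rw [← hdl] at ht
    ext p
    refine omega_of (x := fun n => f^[n] x) (N := N) (t := t) hWr hirr ?_ p
    have hz : Tendsto (fun n : ℕ => 500 * (l ^ n * |w - YY l a t|)) atTop (𝓝 0) := by
      have := ((tendsto_pow_atTop_nhds_zero_of_lt_one hl0.le hl1).mul_const
        |w - YY l a t|).const_mul 500
      simpa using this
    refine squeeze_zero_norm (fun n => ?_) hz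
    rw [Function.iterate_add_apply, hN, hit w hw0 hw1, ← ht n, Real.norm_eq_abs]
    simp only [hW]
    rw [← abs_of_pos (show (0:ℝ) < 500 by norm_num), ← abs_mul,
      abs_of_pos (show (0:ℝ) < 500 by norm_num)]
    apply le_of_eq; congr 1; ring
end

section
/- Let b > 1, let δ be defined from the Fibonacci word, and let f be the piecewise-affine contraction of [0,∞) with parameters v₁ = 1000, v₂ = 500, r = 1/b − 1 and ρ = (500b/(b−1))·(b(1−δ)+1). Then for every interval J ⊂ [0,∞) there exists a constant c_J ≥ 0 such that for every S₀ ≥ 0, the limit lim_{N→∞} (1/N)·#{0 ≤ n ≤ N−1 : fⁿ(S₀) ∈ J} exists and equals c_J. -/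
open Filter Topology

lemma aux_shift (α u : ℝ) (N : ℕ) :
    ∑ n ∈ Finset.range N, ((⌊u + n * α⌋ : ℝ) - ⌊u + n * α - α⌋)
      = ⌊u + N * α - α⌋ - ⌊u - α⌋ := by
  induction N with
  | zero => simp
  | succ k ih =>
    rw [Finset.sum_range_succ, ih]
    have : u + ((k + 1 : ℕ) : ℝ) * α - α = u + k * α := by push_cast; ring
    rw [this]; ring

lemma aux_one (α u : ℝ) :
    Tendsto (fun N : ℕ => (∑ n ∈ Finset.range N, ((⌊u + n * α⌋ : ℝ) - ⌊u + n * α - α⌋)) / N)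
      atTop (𝓝 α) := by
  have h1 : Tendsto (fun N : ℕ => α + (u - α - ⌊u - α⌋) / (N : ℝ) - Int.fract (u + N * α - α) / N)
      atTop (𝓝 (α + 0 - 0)) := by
    refine (tendsto_const_nhds.add (tendsto_const_div_atTop_nhds_zero_nat _)).sub ?_
    refine squeeze_zero (fun N => div_nonneg (Int.fract_nonneg _) (Nat.cast_nonneg _))
      (fun N => ?_) (tendsto_const_div_atTop_nhds_zero_nat (1:ℝ))
    gcongr
    exact (Int.fract_lt_one _).le
  simp only [add_zero, sub_zero] at h1
  refine h1.congr' ?_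
  filter_upwards [eventually_gt_atTop 0] with N hN
  have : (N : ℝ) ≠ 0 := by positivity
  rw [aux_shift, Int.fract]
  field_simp
  ring

lemma aux_int (α u : ℝ) (m j : ℤ) :
    Tendsto (fun N : ℕ => (∑ n ∈ Finset.range N,
      ((⌊u + n * α⌋ : ℝ) - ⌊u + n * α - (m + j * α)⌋)) / N)
      atTop (𝓝 (m + j * α)) := by
  have hm : Tendsto (fun N : ℕ => (m : ℝ) + (∑ n ∈ Finset.range N,
      ((⌊u + n * α⌋ : ℝ) - ⌊u + n * α - j * α⌋)) / N) atTop (𝓝 (m + j * α)) := by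
    refine tendsto_const_nhds.add ?_
    induction j using Int.induction_on with
    | zero => simp
    | succ i ih =>
      have := ih.add (aux_one α (u - i * α))
      convert this using 2 with N
      · rw [← add_div, ← Finset.sum_add_distrib]
        congr 1
        refine Finset.sum_congr rfl fun n _ => ?_
        have e1 : u + n * α - ((i + 1 : ℤ) : ℝ) * α = u - i * α + n * α - α := by push_cast; ring
        have e2 : u + n * α - ((i : ℤ) : ℝ) * α = u - i * α + n * α := by push_cast; ring
        rw [e1, e2]; ring
      · push_cast; ring
    | pred i ih =>
      have := ih.sub (aux_one α (u + i * α + α))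
      convert this using 2 with N
      · rw [← sub_div, ← Finset.sum_sub_distrib]
        congr 1
        refine Finset.sum_congr rfl fun n _ => ?_
        have e1 : u + n * α - ((-i - 1 : ℤ) : ℝ) * α = u + i * α + α + n * α := by push_cast; ring
        have e2 : u + n * α - ((-i : ℤ) : ℝ) * α = u + i * α + α + n * α - α := by push_cast; ring
        rw [e1, e2]; ring
      · push_cast; ring
  refine hm.congr' ?_
  filter_upwards [eventually_gt_atTop 0] with N hN
  have hN' : (N : ℝ) ≠ 0 := by positivity
  rw [eq_div_iff hN', add_mul, div_mul_cancel₀ _ hN']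
  have : (m : ℝ) * N = ∑ n ∈ Finset.range N, (m : ℝ) := by simp [mul_comm]
  rw [this, ← Finset.sum_add_distrib]
  refine Finset.sum_congr rfl fun n _ => ?_
  have e : u + n * α - (m + j * α) = u + n * α - j * α - (m : ℤ) := by ring
  rw [e, Int.floor_sub_intCast]; push_cast; ring

lemma aux_equi (α : ℝ) (hα : Irrational α) (u x : ℝ) :
    Tendsto (fun N : ℕ => (∑ n ∈ Finset.range N,
      ((⌊u + n * α⌋ : ℝ) - ⌊u + n * α - x⌋)) / N) atTop (𝓝 x) := by
  have hd : Dense (AddSubgroup.closure {α, (1:ℝ)} : Set ℝ) := by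
    rw [dense_addSubgroupClosure_pair_iff]; simpa using hα
  have hex : ∀ p q : ℝ, p < q → ∃ m j : ℤ, p < m + j * α ∧ m + j * α < q := by
    intro p q hpq
    obtain ⟨y, hy, hyI⟩ := hd.exists_between hpq
    rw [SetLike.mem_coe, AddSubgroup.mem_closure_pair] at hy
    obtain ⟨j, m, rfl⟩ := hy
    refine ⟨m, j, ?_⟩
    simp only [zsmul_eq_mul, mul_one] at hyI
    rw [add_comm]; exact hyI
  have hmono : ∀ x y : ℝ, x ≤ y → ∀ N : ℕ, (∑ n ∈ Finset.range N,
      ((⌊u + n * α⌋ : ℝ) - ⌊u + n * α - x⌋)) / N ≤ (∑ n ∈ Finset.range N,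
      ((⌊u + n * α⌋ : ℝ) - ⌊u + n * α - y⌋)) / N := by
    intro x y hxy N
    gcongr
  rw [tendsto_order]
  constructor
  · intro p hp
    obtain ⟨m, j, h1, h2⟩ := hex p x hp
    filter_upwards [(aux_int α u m j).eventually (lt_mem_nhds h1)] with N hN
    exact hN.trans_le (hmono _ _ h2.le N)
  · intro p hp
    obtain ⟨m, j, h1, h2⟩ := hex x p hp
    filter_upwards [(aux_int α u m j).eventually (gt_mem_nhds h2)] with N hN
    exact (hmono _ _ h1.le N).trans_lt hN

lemma aux_ind (s x : ℝ) (h0 : 0 ≤ x) (h1 : x ≤ 1) :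
    ((⌊s⌋ : ℝ) - ⌊s - x⌋) = if Int.fract s < x then 1 else 0 := by
  split_ifs with h
  · have : ⌊s - x⌋ = ⌊s⌋ - 1 := by
      rw [Int.floor_eq_iff]; push_cast
      have := Int.fract_nonneg s
      rw [Int.fract] at *
      constructor <;> linarith
    rw [this]; push_cast; ring
  · have : ⌊s - x⌋ = ⌊s⌋ := by
      rw [Int.floor_eq_iff]
      have := Int.fract_lt_one s
      rw [Int.fract] at *
      constructor <;> linarith
    rw [this]; ring

open scoped Classical in
lemma aux_freq (α : ℝ) (hα : Irrational α) (P : ℕ → Prop) (t : ℕ → ℝ) (n0 : ℕ) (u : ℝ)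
    (ht : ∀ n ≥ n0, ∃ m : ℤ, t n = u + n * α - m)
    (h01 : ∀ n ≥ n0, 0 ≤ t n ∧ t n ≤ 1) (a d : ℝ) (ha : 0 ≤ a) (had : a ≤ d) (hd : d ≤ 1)
    (hin : ∀ n ≥ n0, a < t n → t n < d → P n)
    (hout : ∀ n ≥ n0, P n → a ≤ t n ∧ t n ≤ d) :
    Tendsto (fun N : ℕ => (((Finset.range N).filter P).card : ℝ) / N) atTop (𝓝 (d - a)) := by
  have hev : ∀ y : ℝ, ∀ᶠ n in atTop, t n ≠ y := by
    intro y
    by_cases hy : ∃ k ≥ n0, t k = y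
    · obtain ⟨k, hk, hky⟩ := hy
      filter_upwards [eventually_ge_atTop n0, eventually_gt_atTop k] with n hn hnk hc
      obtain ⟨m, hm⟩ := ht n hn
      obtain ⟨m', hm'⟩ := ht k hk
      have hne : ((n : ℤ) - k : ℤ) ≠ 0 := by omega
      have := (hα.intCast_mul hne)
      apply this.ne_int (m - m')
      push_cast
      linarith
    · filter_upwards [eventually_ge_atTop n0] with n hn hc
      exact hy ⟨n, hn, hc⟩
  set F : ℝ → ℕ → ℝ := fun x n => (⌊u + n * α⌋ : ℝ) - ⌊u + n * α - x⌋ with hF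
  have hz : Tendsto (fun n => (if P n then (1:ℝ) else 0) - (F d n - F a n)) atTop (𝓝 0) := by
    refine tendsto_const_nhds.congr' ?_
    filter_upwards [eventually_ge_atTop n0, hev a, hev d, hev 1] with n hn h1 h2 h3
    simp only [hF]
    rw [aux_ind _ d (ha.trans had) hd, aux_ind _ a ha (had.trans hd)]
    have hfr : Int.fract (u + n * α) = t n := by
      obtain ⟨m, hm⟩ := ht n hn
      have : u + n * α = t n + m := by linarith
      rw [this, Int.fract_add_intCast, Int.fract_eq_self]
      exact ⟨(h01 n hn).1, lt_of_le_of_ne (h01 n hn).2 h3⟩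
    rw [hfr]
    by_cases hP : P n
    · obtain ⟨q1, q2⟩ := hout n hn hP
      have q2' := lt_of_le_of_ne q2 h2
      simp [hP, q2', not_lt.2 q1]
    · rcases lt_or_gt_of_ne h1 with h | h
      · simp [hP, h, h.trans_le had]
      · have : ¬ t n < d := fun h' => hP (hin n hn h h')
        simp [hP, this, not_lt.2 h.le]
  have := hz.cesaro.add ((aux_equi α hα u d).sub (aux_equi α hα u a))
  rw [zero_add] at this
  refine this.congr fun N => ?_
  rw [Finset.card_filter]
  push_cast
  rw [Finset.sum_sub_distrib, Finset.sum_sub_distrib]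
  simp only [hF]
  ring

lemma aux_Z (l α : ℝ) (hl0 : 0 < l) (hl1 : l < 1) (hα : α = 2 - phiGolden)
    (hα0 : 0 < α) (hα1 : α < 1) :
    ∃ Z : ℝ → ℝ, Monotone Z ∧ (∀ t, Z (t + 1) = Z t + 1) ∧
      (∀ t, Z (t + α) = (1 - l) * ⌊t⌋ + l * Z t) ∧
      Z 0 = l * (-∑' k : ℕ, (fibWord k : ℝ) * l ^ k) - 1 := by
  have hsum : ∀ t : ℝ, Summable (fun k : ℕ => l ^ k * (⌊t - (k + 1) * α⌋ : ℝ)) := by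
    intro t
    have hn : ‖l‖ < 1 := by rwa [Real.norm_of_nonneg hl0.le]
    have s1 := (summable_pow_mul_geometric_of_norm_lt_one 1 hn).add
      ((summable_geometric_of_lt_one hl0.le hl1).mul_left (|t| + 2))
    refine Summable.of_norm_bounded s1 fun k => ?_
    rw [norm_mul, Real.norm_of_nonneg (pow_nonneg hl0.le k), Real.norm_eq_abs]
    have hb1 : |(⌊t - (k + 1) * α⌋ : ℝ)| ≤ k + (|t| + 2) := by
      have h1 := Int.floor_le (t - (k + 1) * α)
      have h2 := Int.lt_floor_add_one (t - (k + 1) * α)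
      have h3 := le_abs_self t
      have h4 := neg_abs_le t
      have hk : (0:ℝ) ≤ k := Nat.cast_nonneg k
      have h5 : 0 ≤ (k + 1) * α := by positivity
      have h6 : (k + 1) * α ≤ k + 1 := by nlinarith
      rw [abs_le]; constructor <;> linarith
    calc l ^ k * |(⌊t - (k + 1) * α⌋ : ℝ)| ≤ l ^ k * (k + (|t| + 2)) := by gcongr
      _ = _ := by ring
  have hadd : ∀ t : ℝ, (1 - l) * ∑' k : ℕ, l ^ k * (⌊t + α - (k + 1) * α⌋ : ℝ)
      = (1 - l) * ⌊t⌋ + l * ((1 - l) * ∑' k : ℕ, l ^ k * (⌊t - (k + 1) * α⌋ : ℝ)) := by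
    intro t
    rw [(hsum (t + α)).tsum_eq_zero_add]
    have : ∀ k : ℕ, l ^ (k + 1) * (⌊t + α - (((k + 1 : ℕ) : ℝ) + 1) * α⌋ : ℝ)
        = l * (l ^ k * (⌊t - (k + 1) * α⌋ : ℝ)) := by
      intro k
      have : t + α - (((k + 1 : ℕ) : ℝ) + 1) * α = t - (k + 1) * α := by push_cast; ring
      rw [this]; ring
    simp only [this]
    rw [tsum_mul_left]
    have : t + α - (((0 : ℕ) : ℝ) + 1) * α = t := by push_cast; ring
    rw [this]; ring
  refine ⟨fun t => (1 - l) * ∑' k : ℕ, l ^ k * (⌊t - (k + 1) * α⌋ : ℝ), ?_, ?_, hadd, ?_⟩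
  · intro s t hst
    refine mul_le_mul_of_nonneg_left ?_ (by linarith)
    refine Summable.tsum_le_tsum (fun k => ?_) (hsum s) (hsum t)
    gcongr
  · intro t
    have : ∀ k : ℕ, l ^ k * (⌊t + 1 - (k + 1) * α⌋ : ℝ)
        = l ^ k * (⌊t - (k + 1) * α⌋ : ℝ) + l ^ k := by
      intro k
      have : t + 1 - (k + 1) * α = t - (k + 1) * α + 1 := by ring
      rw [this, Int.floor_add_one]; push_cast; ring
    simp only [this]
    rw [(hsum t).tsum_add (summable_geometric_of_lt_one hl0.le hl1),
      tsum_geometric_of_lt_one hl0.le hl1, mul_add, mul_inv_cancel₀ (by linarith)]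
  · have h1 := hadd (-α)
    simp only [neg_add_cancel] at h1
    have hfl : ⌊-α⌋ = -1 := by
      rw [Int.floor_eq_iff]; push_cast; constructor <;> linarith
    rw [hfl] at h1
    have h2 : ∑' k : ℕ, (fibWord k : ℝ) * l ^ k =
        (∑' k : ℕ, l ^ k * (⌊0 - (k + 1) * α⌋ : ℝ)) -
          ∑' k : ℕ, l ^ k * (⌊-α - (k + 1) * α⌋ : ℝ) := by
      rw [← (hsum 0).tsum_sub (hsum (-α))]
      refine tsum_congr fun k => ?_
      have e1 : (0:ℝ) - (k + 1) * α = (k + 1) * phiGolden - ((2 * (k + 1) : ℤ) : ℝ) := by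
        rw [hα]; push_cast; ring
      have e2 : -α - (k + 1) * α = (k + 2) * phiGolden - ((2 * (k + 2) : ℤ) : ℝ) := by
        rw [hα]; push_cast; ring
      rw [e1, e2, Int.floor_sub_intCast, Int.floor_sub_intCast, fibWord]
      push_cast; ring
    rw [h2]
    beta_reduce
    push_cast at h1
    generalize (∑' k : ℕ, l ^ k * (⌊0 - (k + 1) * α⌋ : ℝ)) = A at *
    generalize (∑' k : ℕ, l ^ k * (⌊-α - (k + 1) * α⌋ : ℝ)) = B at *
    have h3 : A = -1 + l * B := by
      have : (1 - l) ≠ 0 := by linarith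
      apply mul_left_cancel₀ this; linarith
    rw [h3]; ring

lemma aux_enter (l c : ℝ) (hl0 : 0 < l) (hl1 : l < 1) (hc0 : c < 0) (hc1 : l * c - 1 < c)
    (G : ℝ → ℝ) (hG : ∀ z, G z = if z < c then l * z else l * z - 1) (z : ℝ) :
    ∃ n, l * c - 1 ≤ G^[n] z ∧ G^[n] z < l * c := by
  have hcl : c < l * c := by nlinarith
  have hpow := tendsto_pow_atTop_nhds_zero_of_lt_one hl0.le hl1
  rcases lt_or_ge z c with hz | hz
  · have hex : ∃ n, c ≤ G^[n] z := by
      by_contra! hcon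
      have hform : ∀ n, G^[n] z = l ^ n * z := by
        intro n
        induction n with
        | zero => simp
        | succ k ih =>
          rw [Function.iterate_succ_apply', hG, if_pos (hcon k), ih]; ring
      have : Tendsto (fun n => G^[n] z) atTop (𝓝 (0 * z)) := by
        simp only [hform]; exact hpow.mul_const z
      have := le_of_tendsto' this (fun n => (hcon n).le)
      linarith
    classical
    have h1 := Nat.find_spec hex
    have h2 : Nat.find hex ≠ 0 := by
      intro h0; rw [h0] at h1; simp at h1; linarith
    obtain ⟨k, hk⟩ := Nat.exists_eq_succ_of_ne_zero h2
    have h3 := Nat.find_min hex (m := k) (by omega)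
    push Not at h3
    rw [hk] at h1
    refine ⟨k + 1, by linarith, ?_⟩
    rw [Function.iterate_succ_apply', hG, if_pos h3]
    nlinarith
  · have hex : ∃ n, G^[n] z < c := by
      by_contra! hcon
      have hform : ∀ n, G^[n] z = l ^ n * (z + 1 / (1 - l)) - 1 / (1 - l) := by
        intro n
        have : (1 - l) ≠ 0 := by linarith
        induction n with
        | zero => simp
        | succ k ih =>
          rw [Function.iterate_succ_apply', hG, if_neg (not_lt.2 (hcon k)), ih]
          field_simp; ring
      have : Tendsto (fun n => G^[n] z) atTop (𝓝 (0 * (z + 1 / (1 - l)) - 1 / (1 - l))) := by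
        simp only [hform]; exact (hpow.mul_const _).sub_const _
      have := ge_of_tendsto' this hcon
      have hpos : 0 < 1 - l := by linarith
      have h5 : (1 / (1 - l)) * (1 - l) = 1 := by field_simp
      nlinarith
    classical
    have h1 := Nat.find_spec hex
    have h2 : Nat.find hex ≠ 0 := by
      intro h0; rw [h0] at h1; simp at h1; linarith
    obtain ⟨k, hk⟩ := Nat.exists_eq_succ_of_ne_zero h2
    have h3 := Nat.find_min hex (m := k) (by omega)
    push Not at h3
    rw [hk] at h1
    refine ⟨k + 1, ?_, by linarith⟩
    rw [Function.iterate_succ_apply', hG, if_neg (not_lt.2 h3)]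
    nlinarith

lemma aux_dyn (l c α : ℝ) (hl0 : 0 < l) (hl1 : l < 1) (hc0 : c < 0) (hc1 : l * c - 1 < c)
    (hα : Irrational α)
    (G : ℝ → ℝ) (hG : ∀ z, G z = if z < c then l * z else l * z - 1)
    (Z : ℝ → ℝ) (hm : Monotone Z) (hZ1 : ∀ t, Z (t + 1) = Z t + 1)
    (hZα : ∀ t, Z (t + α) = (1 - l) * ⌊t⌋ + l * Z t) (hZ0 : Z 0 = l * c - 1)
    (J : Set ℝ) (hJ : J.OrdConnected) :
    ∃ C : ℝ, 0 ≤ C ∧ ∀ z, Tendsto (fun N => (visitCount G z J N : ℝ) / N) atTop (𝓝 C) := by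
  have hcl : c < l * c := by nlinarith
  set K : Set ℝ := Set.Ico (l * c - 1) (l * c) with hK
  set h : ℝ → ℝ := fun z => sSup {t | Z t ≤ z} with hh
  have hne : ∀ z ∈ K, {t | Z t ≤ z}.Nonempty := fun z hz => ⟨0, by
    simp only [Set.mem_ofPred_eq, hZ0]; exact hz.1⟩
  have hZone : Z 1 = l * c := by have := hZ1 0; rw [zero_add] at this; rw [this, hZ0]; ring
  have hub : ∀ z ∈ K, ∀ t, Z t ≤ z → t < 1 := by
    intro z hz t ht
    by_contra! h1
    have := hm h1
    have := hz.2
    linarith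
  have hbdd : ∀ z ∈ K, BddAbove {t | Z t ≤ z} := fun z hz => ⟨1, fun t ht => (hub z hz t ht).le⟩
  have hh01 : ∀ z ∈ K, 0 ≤ h z ∧ h z ≤ 1 := fun z hz =>
    ⟨le_csSup (hbdd z hz) (by simp only [Set.mem_ofPred_eq, hZ0]; exact hz.1),
      csSup_le (hne z hz) fun t ht => (hub z hz t ht).le⟩
  have hmono : ∀ z ∈ K, ∀ w ∈ K, z ≤ w → h z ≤ h w := fun z hz w hw hzw =>
    csSup_le_csSup (hbdd w hw) (hne z hz) fun t ht => le_trans ht hzw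
  have hset : ∀ z ∈ K, {t | Z t ≤ l * z} = (OrderIso.addRight α) '' {t | Z t ≤ z} := by
    intro z hz
    have key : ∀ t, Z (t + α) ≤ l * z ↔ Z t ≤ z := by
      intro t
      rw [hZα]
      constructor
      · intro h1
        by_contra! h2
        have : 0 ≤ t := by
          by_contra! h3
          have := hm h3.le
          have := hz.1
          linarith
        have h4 : (0:ℝ) ≤ ⌊t⌋ := by exact_mod_cast Int.floor_nonneg.2 this
        nlinarith
      · intro h1
        have h2 := hub z hz t h1
        have h3 : ⌊t⌋ < 1 := Int.floor_lt.2 (by exact_mod_cast h2)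
        have h4 : (⌊t⌋ : ℝ) ≤ 0 := by exact_mod_cast Int.lt_add_one_iff.1 h3
        nlinarith
    ext t
    simp only [Set.mem_ofPred_eq, Set.mem_image, OrderIso.addRight_apply]
    constructor
    · intro ht
      refine ⟨t - α, ?_, by ring⟩
      rw [← key]; simpa using ht
    · rintro ⟨s, hs, rfl⟩
      exact (key s).2 hs
  have hset1 : ∀ w, {t | Z t ≤ w - 1} = (OrderIso.addRight (-1)) '' {t | Z t ≤ w} := by
    intro w
    ext t
    simp only [Set.mem_ofPred_eq, Set.mem_image, OrderIso.addRight_apply]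
    constructor
    · intro ht
      exact ⟨t + 1, by rw [hZ1]; linarith, by ring⟩
    · rintro ⟨s, hs, rfl⟩
      have := hZ1 (s + -1)
      rw [neg_add_cancel_right] at this
      linarith
  have hstep1 : ∀ z ∈ K, h (l * z) = h z + α := by
    intro z hz
    simp only [hh]
    rw [hset z hz, ← OrderIso.map_csSup' _ (hne z hz) (hbdd z hz)]
    rfl
  have hstep2 : ∀ z ∈ K, h (l * z - 1) = h z + α - 1 := by
    intro z hz
    rw [← hstep1 z hz]
    simp only [hh]
    rw [hset1, ← OrderIso.map_csSup' _]
    · rfl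
    · rw [hset z hz]; exact (hne z hz).image _
    · rw [hset z hz]; exact (OrderIso.addRight α).monotone.map_bddAbove (hbdd z hz)
  have hGK : ∀ z ∈ K, G z ∈ K := by
    intro z hz
    have h1 := hz.1
    have h2 := hz.2
    rw [hG, hK]
    split_ifs with hzc
    · constructor <;> nlinarith
    · push Not at hzc
      constructor <;> nlinarith
  have hstep : ∀ z ∈ K, ∃ m : ℤ, h (G z) = h z + α - m := by
    intro z hz
    rw [hG]
    split_ifs
    · exact ⟨0, by rw [hstep1 z hz]; simp⟩
    · exact ⟨1, by rw [hstep2 z hz]; simp⟩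
  have horb : ∀ z ∈ K, ∀ k, G^[k] z ∈ K ∧ ∃ m : ℤ, h (G^[k] z) = h z + k * α - m := by
    intro z hz k
    induction k with
    | zero => exact ⟨hz, 0, by simp⟩
    | succ k ih =>
      obtain ⟨h1, m, h2⟩ := ih
      rw [Function.iterate_succ_apply']
      refine ⟨hGK _ h1, ?_⟩
      obtain ⟨m', hm'⟩ := hstep _ h1
      exact ⟨m + m', by rw [hm', h2]; push_cast; ring⟩
  -- the endpoints
  have hends : ∃ a d : ℝ, 0 ≤ a ∧ a ≤ d ∧ d ≤ 1 ∧
      (∀ z ∈ K, a < h z → h z < d → z ∈ J) ∧ (∀ z ∈ K, z ∈ J → a ≤ h z ∧ h z ≤ d) := by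
    rcases (h '' (J ∩ K)).eq_empty_or_nonempty with he | hn
    · refine ⟨0, 0, le_rfl, le_rfl, zero_le_one, fun z _ h1 h2 => ?_, fun z hz hzJ => ?_⟩
      · linarith
      · have : h z ∈ h '' (J ∩ K) := ⟨z, ⟨hzJ, hz⟩, rfl⟩
        rw [he] at this; exact this.elim
    · have hbb : BddBelow (h '' (J ∩ K)) := ⟨0, by
        rintro _ ⟨z, hz, rfl⟩; exact (hh01 z hz.2).1⟩
      have hba : BddAbove (h '' (J ∩ K)) := ⟨1, by
        rintro _ ⟨z, hz, rfl⟩; exact (hh01 z hz.2).2⟩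
      refine ⟨sInf (h '' (J ∩ K)), sSup (h '' (J ∩ K)), ?_, csInf_le_csSup hn hbb hba, ?_, ?_, ?_⟩
      · exact le_csInf hn (by rintro _ ⟨z, hz, rfl⟩; exact (hh01 z hz.2).1)
      · exact csSup_le hn (by rintro _ ⟨z, hz, rfl⟩; exact (hh01 z hz.2).2)
      · intro z hz h1 h2
        obtain ⟨_, ⟨w, hw, rfl⟩, hw1⟩ := exists_lt_of_csInf_lt hn h1
        obtain ⟨_, ⟨y, hy, rfl⟩, hy1⟩ := exists_lt_of_lt_csSup hn h2
        refine hJ.out hw.1 hy.1 ⟨?_, ?_⟩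
        · by_contra! hc
          have := hmono z hz w hw.2 hc.le
          linarith
        · by_contra! hc
          have := hmono y hy.2 z hz hc.le
          linarith
      · intro z hz hzJ
        exact ⟨csInf_le hbb ⟨z, ⟨hzJ, hz⟩, rfl⟩, le_csSup hba ⟨z, ⟨hzJ, hz⟩, rfl⟩⟩
  obtain ⟨a, d, ha, had, hd, hin, hout⟩ := hends
  refine ⟨d - a, by linarith, fun z => ?_⟩
  obtain ⟨n0, hn0⟩ := aux_enter l c hl0 hl1 hc0 hc1 G hG z
  have hn0K : G^[n0] z ∈ K := hn0
  have hall : ∀ n ≥ n0, G^[n] z ∈ K ∧ ∃ m : ℤ, h (G^[n] z) = (h (G^[n0] z) - n0 * α) + n * α - m := by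
    intro n hn
    obtain ⟨k, rfl⟩ := Nat.exists_eq_add_of_le hn
    obtain ⟨h1, m, h2⟩ := horb _ hn0K k
    rw [← Function.iterate_add_apply, add_comm k n0] at h1 h2
    exact ⟨h1, m, by rw [h2]; push_cast; ring⟩
  exact aux_freq α hα (fun n => G^[n] z ∈ J) (fun n => h (G^[n] z)) n0 _
    (fun n hn => (hall n hn).2) (fun n hn => hh01 _ (hall n hn).1) a d ha had hd
    (fun n hn => hin _ (hall n hn).1) (fun n hn => hout _ (hall n hn).1)

lemma aux_phi : 1.6 < phiGolden ∧ phiGolden < 1.65 := by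
  have h5 : Real.sqrt 5 ^ 2 = 5 := Real.sq_sqrt (by norm_num)
  have h0 := Real.sqrt_nonneg 5
  rw [phiGolden]
  constructor <;> nlinarith

lemma aux_omega (k : ℕ) : 0 ≤ fibWord k ∧ fibWord k ≤ 1 := by
  obtain ⟨h1, h2⟩ := aux_phi
  have e : ((k : ℝ) + 2) * phiGolden = ((k : ℝ) + 1) * phiGolden + phiGolden := by ring
  rw [fibWord, e]
  generalize ((k : ℝ) + 1) * phiGolden = x
  have a1 : ⌊x⌋ + 1 ≤ ⌊x + phiGolden⌋ := by
    rw [Int.le_floor]; push_cast; have := Int.floor_le x; linarith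
  have a2 : ⌊x + phiGolden⌋ < ⌊x⌋ + 3 := by
    rw [Int.floor_lt]; push_cast; have := Int.lt_floor_add_one x; linarith
  omega

lemma aux_omega0 : fibWord 0 = 0 ∧ fibWord 1 = 1 := by
  obtain ⟨h1, h2⟩ := aux_phi
  have f1 : ⌊(1:ℝ) * phiGolden⌋ = 1 := by rw [Int.floor_eq_iff]; push_cast; constructor <;> linarith
  have f2 : ⌊(2:ℝ) * phiGolden⌋ = 3 := by rw [Int.floor_eq_iff]; push_cast; constructor <;> linarith
  have f3 : ⌊(3:ℝ) * phiGolden⌋ = 4 := by rw [Int.floor_eq_iff]; push_cast; constructor <;> linarith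
  constructor
  · rw [fibWord]; push_cast; rw [zero_add, zero_add, f1, f2]; norm_num
  · rw [fibWord]; push_cast
    rw [show (1:ℝ) + 1 = 2 by norm_num, show (1:ℝ) + 2 = 3 by norm_num, f2, f3]; norm_num

lemma aux_Omega (l : ℝ) (hl0 : 0 < l) (hl1 : l < 1) :
    0 < ∑' k : ℕ, (fibWord k : ℝ) * l ^ k ∧
      (1 - l) * ∑' k : ℕ, (fibWord k : ℝ) * l ^ k < 1 := by
  have hgeo := summable_geometric_of_lt_one hl0.le hl1
  have hc : ∀ k, (0:ℝ) ≤ fibWord k ∧ (fibWord k : ℝ) ≤ 1 := fun k => by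
    exact_mod_cast aux_omega k
  have hle : ∀ k : ℕ, (fibWord k : ℝ) * l ^ k ≤ l ^ k := fun k =>
    mul_le_of_le_one_left (pow_nonneg hl0.le k) (hc k).2
  have hnn : ∀ k : ℕ, 0 ≤ (fibWord k : ℝ) * l ^ k := fun k =>
    mul_nonneg (hc k).1 (pow_nonneg hl0.le k)
  have hs : Summable (fun k : ℕ => (fibWord k : ℝ) * l ^ k) :=
    Summable.of_nonneg_of_le hnn hle hgeo
  constructor
  · refine hs.tsum_pos hnn 1 ?_
    rw [aux_omega0.2]; simpa using hl0
  · have : ∑' k : ℕ, (fibWord k : ℝ) * l ^ k < ∑' k : ℕ, l ^ k :=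
      Summable.tsum_lt_tsum hle (i := 0) (by rw [aux_omega0.1]; simp) hs hgeo
    rw [tsum_geometric_of_lt_one hl0.le hl1] at this
    have hp : 0 < 1 - l := by linarith
    calc _ < (1 - l) * (1 - l)⁻¹ := by gcongr
      _ = 1 := mul_inv_cancel₀ hp.ne'

theorem stmt3 (b : ℝ) (hb : 1 < b) :
    ∀ J : Set ℝ, J ⊆ Set.Ici 0 → J.OrdConnected →
      ∃ c : ℝ, 0 ≤ c ∧ ∀ S₀ : ℝ, 0 ≤ S₀ →
        Tendsto
          (fun N => (visitCount (pwc (1 / b - 1) 1000 500 (rhoParam b)) S₀ J N : ℝ) / N)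
          atTop (𝓝 c) := by
  intro J _ hJ
  have hb0 : 0 < b := by linarith
  obtain ⟨l, hl⟩ : ∃ l, l = 1 / b := ⟨_, rfl⟩
  have hl0 : 0 < l := by rw [hl]; positivity
  have hl1 : l < 1 := by rw [hl, div_lt_one hb0]; exact hb
  have hp : 0 < 1 - l := by linarith
  have hbl : b = 1 / l := by rw [hl]; simp
  obtain ⟨hφ1, hφ2⟩ := aux_phi
  have hirr : Irrational (2 - phiGolden) := by
    have : phiGolden = Real.goldenRatio := rfl
    rw [this]
    exact_mod_cast Real.goldenRatio_irrational.intCast_sub 2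
  obtain ⟨hΩ0, hΩ1⟩ := aux_Omega l hl0 hl1
  obtain ⟨Z, hm, hZ1, hZα, hZ0⟩ := aux_Z l (2 - phiGolden) hl0 hl1 rfl (by linarith) (by linarith)
  set c : ℝ := -∑' k : ℕ, (fibWord k : ℝ) * l ^ k with hc
  have hρ : rhoParam b = 500 * (c + 2 / (1 - l)) := by
    rw [rhoParam, fibDelta, ← hl]
    have e : (∑' k : ℕ, (fibWord k : ℝ) * l ^ k) = -c := by rw [hc, neg_neg]
    rw [e, hbl]
    have : (1 : ℝ) / l - 1 ≠ 0 := by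
      rw [← hbl]; linarith
    have h2 : 1 / l - 1 = (1 - l) / l := by field_simp
    rw [h2]
    field_simp
    ring
  set G : ℝ → ℝ := fun z => if z < c then l * z else l * z - 1 with hG
  set p : ℝ → ℝ := fun z => 500 * (z + 2 / (1 - l)) with hpdef
  have hpm : Monotone p := fun x y hxy => by simp only [hpdef]; gcongr
  obtain ⟨C, hC0, hC⟩ := aux_dyn l c (2 - phiGolden) hl0 hl1 (by linarith) (by
    rw [hc]; linarith) hirr G (fun z => rfl) Z hm hZ1 hZα hZ0 (p ⁻¹' J) (hJ.preimage_mono hpm)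
  refine ⟨C, hC0, fun S₀ _ => ?_⟩
  have hsemi : Function.Semiconj p G (pwc (1 / b - 1) 1000 500 (rhoParam b)) := by
    intro z
    rw [pwc, hρ, ← hl]
    have hiff : p z < 500 * (c + 2 / (1 - l)) ↔ z < c := by
      simp only [hpdef]
      constructor <;> intro h <;> linarith
    simp only [hiff, hG]
    have : 1 - l ≠ 0 := hp.ne'
    split_ifs
    · simp only [hpdef]; field_simp; ring
    · simp only [hpdef]; field_simp; ring
  have hS : p (S₀ / 500 - 2 / (1 - l)) = S₀ := by simp only [hpdef]; ring
  refine (hC (S₀ / 500 - 2 / (1 - l))).congr fun N => ?_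
  have : ∀ n, p (G^[n] (S₀ / 500 - 2 / (1 - l))) =
      (pwc (1 / b - 1) 1000 500 (rhoParam b))^[n] S₀ := by
    intro n
    rw [(hsemi.iterate_right n).eq, hS]
  classical
  congr 2
  unfold visitCount
  congr 1
  ext n
  simp only [Finset.mem_filter, Set.mem_preimage, this]
end

section
/- Let r ∈ (−1,0), v₁, v₂ ≥ 0 with v₁ ≠ v₂, and ρ > 0, and let f be the associated piecewise-affine contraction of [0,∞). If S₀ ≥ 0 is such that the ω-limit set ω_f(S₀) is a finite set, then the orbit sequence (fⁿ(S₀))_{n≥0} is asymptotic to a periodic sequence. -/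
open Filter Topology

lemma aux_small (C : Set ℝ) (hC : C.Finite) (u : ℕ → ℝ) (hu : Tendsto u atTop (𝓝 0)) :
    ∀ᶠ n in atTop, ∀ c ∈ C, c ≠ 0 → |u n| < |c| := by
  rw [hC.eventually_all]
  intro c _
  by_cases h : c = 0
  · simp [h]
  · have h1 : Tendsto (fun n => |u n|) atTop (𝓝 0) := by simpa using hu.abs
    filter_upwards [h1.eventually (gt_mem_nhds (abs_pos.mpr h))] with n hn _
    exact hn

lemma aux_near (x : ℕ → ℝ) (M : ℝ) (hx : ∀ n, x n ∈ Set.Icc 0 M) (A : Set ℝ)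
    (hA : A = {p : ℝ | ∃ n : ℕ → ℕ, StrictMono n ∧ Tendsto (fun k => x (n k)) atTop (𝓝 p)})
    (hfin : A.Finite) :
    ∃ p : ℕ → ℝ, (∀ n, p n ∈ A) ∧ Tendsto (fun n => x n - p n) atTop (𝓝 0) := by
  have hne : A.Nonempty := by
    obtain ⟨a, _, φ, hφ, hl⟩ := isCompact_Icc.tendsto_subseq hx
    exact ⟨a, by rw [hA]; exact ⟨φ, hφ, hl⟩⟩
  have hex : ∀ n, ∃ q ∈ A, Metric.infDist (x n) A = dist (x n) q := fun n =>
    hfin.isCompact.exists_infDist_eq_dist hne (x n)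
  choose p hp hd using hex
  refine ⟨p, hp, ?_⟩
  rw [Metric.tendsto_atTop]
  by_contra hcon
  push Not at hcon
  obtain ⟨ε, hε, hcon⟩ := hcon
  obtain ⟨φ, hφ, hφ2⟩ := Nat.exists_strictMono_subsequence (P := fun n => ε ≤ dist (x n - p n) 0) (by
    intro N
    obtain ⟨n, h1, h2⟩ := hcon (N+1)
    exact ⟨n, by omega, h2⟩)
  obtain ⟨a, _, ψ, hψ, hl⟩ := isCompact_Icc.tendsto_subseq (fun n => hx (φ n))
  have ha : a ∈ A := by rw [hA]; exact ⟨φ ∘ ψ, hφ.comp hψ, hl⟩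
  rw [Metric.tendsto_atTop] at hl
  obtain ⟨K, hK⟩ := hl ε hε
  have h1 := hK K le_rfl
  have h2 := hφ2 (ψ K)
  have h3 := Metric.infDist_le_dist_of_mem (x := x (φ (ψ K))) ha
  rw [hd] at h3
  simp only [Real.dist_eq, sub_zero, Function.comp] at *
  linarith

theorem stmt4 (r v₁ v₂ ρ : ℝ) (hr₁ : -1 < r) (hr₂ : r < 0)
    (hv₁ : 0 ≤ v₁) (hv₂ : 0 ≤ v₂) (hne : v₁ ≠ v₂) (hρ : 0 < ρ)
    (S₀ : ℝ) (hS₀ : 0 ≤ S₀)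
    (hfin : (omegaLim (pwc r v₁ v₂ ρ) S₀).Finite) :
    ∃ a : ℕ → ℝ, IsPeriodicSeq a ∧
      AsymptoticTo (fun n => (pwc r v₁ v₂ ρ)^[n] S₀) a := by
  set x : ℕ → ℝ := fun n => (pwc r v₁ v₂ ρ)^[n] S₀ with hxdef
  set A := omegaLim (pwc r v₁ v₂ ρ) S₀ with hAdef
  obtain ⟨s, hs⟩ : ∃ s : ℕ → ℝ, s = fun n => if x n < ρ then v₁ else v₂ := ⟨_, rfl⟩
  have hstep : ∀ n, x (n+1) = (1 + r) * x n + s n := by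
    intro n
    simp only [hxdef, hs, Function.iterate_succ_apply']
    rw [pwc]
    split_ifs <;> rfl
  have hs12 : ∀ n, s n ∈ ({v₁, v₂} : Set ℝ) := by
    intro n; rw [hs]; dsimp only; split_ifs <;> simp
  have hs0 : ∀ n, 0 ≤ s n ∧ s n ≤ v₁ + v₂ := by
    intro n
    rcases hs12 n with h | h
    · rw [h]; constructor <;> linarith
    · rw [Set.mem_singleton_iff.mp h]; constructor <;> linarith
  obtain ⟨M, hM⟩ : ∃ M, M = S₀ + (v₁ + v₂) / (-r) := ⟨_, rfl⟩
  have hMr : (v₁ + v₂) ≤ (-r) * M := by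
    have : (-r) * M = (-r) * S₀ + (v₁ + v₂) := by
      rw [hM, mul_add, mul_div_cancel₀ _ (neg_ne_zero.mpr hr₂.ne)]
    nlinarith
  have hx : ∀ n, x n ∈ Set.Icc 0 M := by
    intro n
    induction n with
    | zero =>
      refine ⟨hS₀, ?_⟩
      have : 0 ≤ (v₁ + v₂) / (-r) := div_nonneg (by linarith) (by linarith)
      change S₀ ≤ M
      linarith
    | succ k ih =>
      obtain ⟨h1, h2⟩ := ih
      obtain ⟨h3, h4⟩ := hs0 k
      rw [hstep]
      constructor
      · have := mul_nonneg (by linarith : 0 ≤ 1 + r) h1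
        linarith
      · have := mul_le_mul_of_nonneg_left h2 (by linarith : 0 ≤ 1 + r)
        linarith
  obtain ⟨p, hpA, hp⟩ := aux_near x M hx A rfl hfin
  -- exact recursion for p
  have hy : Tendsto (fun n => (1 + r) * p n + s n - p (n+1)) atTop (𝓝 0) := by
    have h1 := (hp.comp (tendsto_add_atTop_nat 1)).sub (hp.const_mul (1 + r))
    simp only [mul_zero, sub_zero] at h1
    refine h1.congr fun n => ?_
    simp only [Function.comp, hstep n]
    ring
  have hC1 : ((fun t : (ℝ × ℝ) × ℝ => (1 + r) * t.1.1 + t.1.2 - t.2) ''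
      ((A ×ˢ {v₁, v₂}) ×ˢ A)).Finite :=
    ((hfin.prod (by simp)).prod hfin).image _
  have e1 := aux_small _ hC1 _ hy
  have hC2 : ((fun t => t - ρ) '' A).Finite := hfin.image _
  have e2 := aux_small _ hC2 _ hp
  obtain ⟨N, hN⟩ := eventually_atTop.mp (e1.and e2)
  have hrec : ∀ n ≥ N, p (n+1) = (1 + r) * p n + s n := by
    intro n hn
    have h := (hN n hn).1 _ ⟨((p n, s n), p (n+1)), ⟨⟨hpA n, hs12 n⟩, hpA _⟩, rfl⟩
    by_contra hc
    exact lt_irrefl _ (h (fun h0 => hc (by linarith)))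
  have hdiff : ∀ k, x (N + k) - p (N + k) = (1 + r) ^ k * (x N - p N) := by
    intro k
    induction k with
    | zero => simp
    | succ k ih =>
      rw [← add_assoc, hrec _ (by omega), hstep, pow_succ]
      linear_combination (1 + r) * ih
  have hsign : ∀ n ≥ N, (x n < p n ↔ x N < p N) := by
    intro n hn
    obtain ⟨k, rfl⟩ := Nat.exists_eq_add_of_le hn
    have h := hdiff k
    have hpos : 0 < (1 + r) ^ k := pow_pos (by linarith) k
    rw [← sub_neg, h, ← sub_neg (a := x N)]
    constructor
    · intro h'; by_contra hc; exact absurd (mul_nonneg hpos.le (not_lt.mp hc)) (not_le.mpr h')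
    · exact mul_neg_of_pos_of_neg hpos
  have hside : ∀ n ≥ N, (x n < ρ ↔ (p n < ρ ∨ (p n = ρ ∧ x N < p N))) := by
    intro n hn
    by_cases h : p n = ρ
    · rw [← hsign n hn, h]; simp
    · have h2 := (hN n hn).2 _ ⟨p n, hpA n, rfl⟩ (sub_ne_zero.mpr h)
      simp only [h, false_and, or_false]
      rcases lt_or_gt_of_ne h with h' | h'
      · rw [abs_of_neg (sub_neg.mpr h')] at h2
        have := (abs_lt.mp h2).2
        exact iff_of_true (by linarith) h'
      · rw [abs_of_pos (sub_pos.mpr h')] at h2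
        have := (abs_lt.mp h2).1
        exact iff_of_false (by linarith) (by linarith)
  have hdet : ∀ n ≥ N, ∀ m ≥ N, p n = p m → p (n+1) = p (m+1) := by
    intro n hn m hm h
    have : s n = s m := by
      simp only [hs, hside n hn, hside m hm, h]
    rw [hrec n hn, hrec m hm, h, this]
  obtain ⟨i, d, hi, hd, hid⟩ : ∃ i d, N ≤ i ∧ 1 ≤ d ∧ p (i + d) = p i := by
    have hnot : ¬ Set.InjOn p (Set.Ici N) := fun hinj =>
      (Set.infinite_of_injOn_mapsTo hinj (fun n _ => hpA n) (Set.Ici_infinite N)) hfin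
    simp only [Set.InjOn] at hnot
    push Not at hnot
    obtain ⟨a, ha, b, hb, hab, hne'⟩ := hnot
    simp only [Set.mem_Ici] at ha hb
    rcases lt_or_gt_of_ne hne' with h | h
    · exact ⟨a, b - a, ha, by omega, by rw [Nat.add_sub_cancel' h.le, hab]⟩
    · exact ⟨b, a - b, hb, by omega, by rw [Nat.add_sub_cancel' h.le, hab]⟩
  have hper : ∀ n ≥ i, p (n + d) = p n := by
    intro n hn
    induction n, hn using Nat.le_induction with
    | base => exact hid
    | succ n hn ih =>
      rw [add_right_comm]
      exact hdet _ (by omega) _ (by omega) ih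
  have hper2 : ∀ k, ∀ n ≥ i, p (n + d * k) = p n := by
    intro k n hn
    induction k with
    | zero => simp
    | succ k ih =>
      rw [Nat.mul_succ, ← add_assoc, hper _ (by omega), ih]
  refine ⟨fun n => p (n + d * i), ⟨d, hd, fun n => ?_⟩, ?_⟩
  · have : i ≤ d * i := Nat.le_mul_of_pos_left i hd
    dsimp only
    rw [add_right_comm]
    exact hper _ (by omega)
  · have h1 : Tendsto (fun n => |x n - p n|) atTop (𝓝 0) := by simpa using hp.abs
    refine h1.congr' ?_
    filter_upwards [eventually_ge_atTop i] with n hn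
    rw [hper2 i n hn]
end

section
/- Let b > 1 and let δ be defined from the Fibonacci word. Let g : [0,1] → [0,1] be defined by g(x) = x/b + δ for x ∈ [0, b(1−δ)) and g(x) = x/b + δ − 1 for x ∈ [b(1−δ), 1], and let T : [0,1] → [0,1] be the rotation by α = (3−√5)/2. Then g and T are topologically semiconjugate: there exists a continuous, nondecreasing, surjective map h : [0,1] → [0,1] such that h ∘ g = T ∘ h. -/
open Filter Topology

lemma sA_irr : Irrational alphaRot := by
  have h5 : Irrational (Real.sqrt 5) := by
    simpa using (show Nat.Prime 5 by norm_num).irrational_sqrt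
  have : alphaRot = ((3 / 2 : ℚ) : ℝ) - ((1 / 2 : ℚ) : ℝ) * Real.sqrt 5 := by
    unfold alphaRot; push_cast; ring
  rw [this]
  exact (h5.ratCast_mul (by norm_num)).ratCast_sub _

lemma sA_pos : 0 < alphaRot := by
  unfold alphaRot
  have : Real.sqrt 5 < 3 := by rw [Real.sqrt_lt' (by norm_num)]; norm_num
  linarith

lemma sA_lt : alphaRot < 1 := by
  unfold alphaRot
  have : 1 < Real.sqrt 5 := by rw [Real.lt_sqrt (by norm_num)]; norm_num
  linarith

lemma sA_word (k : ℕ) : fibWord k =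
    ⌊(0 : ℝ) - ((k : ℝ) + 1) * alphaRot⌋ - ⌊(0 : ℝ) - ((k : ℝ) + 2) * alphaRot⌋ := by
  have e : alphaRot = 2 - phiGolden := by unfold alphaRot phiGolden; ring
  have e1 : (0 : ℝ) - ((k : ℝ) + 1) * alphaRot
      = ((k : ℝ) + 1) * phiGolden - ((2 * (k + 1) : ℤ) : ℝ) := by
    rw [e]; push_cast; ring
  have e2 : (0 : ℝ) - ((k : ℝ) + 2) * alphaRot
      = ((k : ℝ) + 2) * phiGolden - ((2 * (k + 2) : ℤ) : ℝ) := by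
    rw [e]; push_cast; ring
  rw [e1, e2, Int.floor_sub_intCast, Int.floor_sub_intCast]
  unfold fibWord
  ring

/-- general term -/
noncomputable def sF (r y : ℝ) (k : ℕ) : ℝ := r ^ k * (⌊y - ((k : ℝ) + 1) * alphaRot⌋ : ℝ)

noncomputable def sS (r y : ℝ) : ℝ := ∑' k, sF r y k

lemma sF_bound {r : ℝ} (h0 : 0 < r) (y M : ℝ) (hM : |y| ≤ M) (k : ℕ) :
    ‖sF r y k‖ ≤ (M + 2) * r ^ k + (k : ℝ) ^ 1 * r ^ k := by
  have hp : 0 < r ^ k := pow_pos h0 k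
  have h : |(⌊y - ((k : ℝ) + 1) * alphaRot⌋ : ℝ)| ≤ M + 2 + k := by
    have h1 := Int.floor_le (y - ((k : ℝ) + 1) * alphaRot)
    have h2 := Int.lt_floor_add_one (y - ((k : ℝ) + 1) * alphaRot)
    have h3 : 0 < ((k : ℝ) + 1) * alphaRot := mul_pos (by positivity) sA_pos
    have h4 : ((k : ℝ) + 1) * alphaRot ≤ (k : ℝ) + 1 :=
      mul_le_of_le_one_right (by positivity) sA_lt.le
    rw [abs_le] at hM ⊢
    constructor <;> linarith
  rw [sF, Real.norm_eq_abs, abs_mul, abs_of_pos hp]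
  nlinarith

lemma sB_summable {r : ℝ} (h0 : 0 < r) (h1 : r < 1) (M : ℝ) :
    Summable (fun k : ℕ => (M + 2) * r ^ k + (k : ℝ) ^ 1 * r ^ k) := by
  refine ((summable_geometric_of_lt_one h0.le h1).mul_left _).add ?_
  exact summable_pow_mul_geometric_of_norm_lt_one 1 (by rwa [Real.norm_eq_abs, abs_of_pos h0])

lemma sF_summable {r : ℝ} (h0 : 0 < r) (h1 : r < 1) (y : ℝ) : Summable (sF r y) :=
  Summable.of_norm_bounded (sB_summable h0 h1 |y|) (sF_bound h0 y _ le_rfl)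

lemma sS_rot {r : ℝ} (h0 : 0 < r) (h1 : r < 1) (y : ℝ) :
    sS r (y + alphaRot) = ⌊y⌋ + r * sS r y := by
  unfold sS
  rw [(sF_summable h0 h1 _).tsum_eq_zero_add, ← tsum_mul_left]
  congr 1
  · simp [sF]
  · congr 1; ext k
    have : y + alphaRot - (((k + 1 : ℕ) : ℝ) + 1) * alphaRot = y - ((k : ℝ) + 1) * alphaRot := by
      push_cast; ring
    rw [sF, sF, this]; ring

lemma sS_add_one {r : ℝ} (h0 : 0 < r) (h1 : r < 1) (y : ℝ) :
    (1 - r) * sS r (y + 1) = (1 - r) * sS r y + 1 := by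
  have : sS r (y + 1) = sS r y + ∑' k : ℕ, r ^ k := by
    unfold sS
    rw [← (sF_summable h0 h1 _).tsum_add (summable_geometric_of_lt_one h0.le h1)]
    congr 1; ext k
    have : y + 1 - ((k : ℝ) + 1) * alphaRot = y - ((k : ℝ) + 1) * alphaRot + 1 := by ring
    rw [sF, sF, this, Int.floor_add_one]; push_cast; ring
  rw [this, tsum_geometric_of_lt_one h0.le h1]
  have : 1 - r ≠ 0 := by linarith
  field_simp

lemma sA_dense {y z : ℝ} (h : y < z) : ∃ (k : ℕ) (m : ℤ),
    y < m + ((k : ℝ) + 1) * alphaRot ∧ m + ((k : ℝ) + 1) * alphaRot < z := by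
  have hd : DenseRange (fun n : ℕ => n • (alphaRot : AddCircle (1 : ℝ))) := by
    rw [← denseRange_zsmul_iff_nsmul]
    rw [AddCircle.denseRange_zsmul_coe_iff]
    simpa using sA_irr
  have ho : IsOpen ((fun x : ℝ => (x : AddCircle (1 : ℝ))) '' Set.Ioo (y - alphaRot) (z - alphaRot)) :=
    QuotientAddGroup.isOpenMap_coe _ isOpen_Ioo
  obtain ⟨k, hk⟩ := hd.exists_mem_open ho
    (Set.Nonempty.image _ (Set.nonempty_Ioo.2 (by linarith)))
  obtain ⟨x, hx, hxe⟩ := hk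
  have hxe' : ((k * alphaRot : ℝ) : AddCircle (1 : ℝ)) = (x : AddCircle (1 : ℝ)) := by
    refine Eq.trans ?_ hxe.symm; simp [← nsmul_eq_mul]
  rw [← sub_eq_zero, ← AddCircle.coe_sub, AddCircle.coe_eq_zero_iff] at hxe'
  obtain ⟨m, hm⟩ := hxe'
  simp only [zsmul_eq_mul, mul_one] at hm
  refine ⟨k, -m, ?_, ?_⟩ <;> push_cast <;> linarith [hx.1, hx.2]

lemma sS_strictMono {r : ℝ} (h0 : 0 < r) (h1 : r < 1) : StrictMono (sS r) := by
  intro y z hyz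
  obtain ⟨k, m, hk1, hk2⟩ := sA_dense hyz
  refine Summable.tsum_lt_tsum (i := k) ?_ ?_ (sF_summable h0 h1 y) (sF_summable h0 h1 z)
  · intro j
    unfold sF
    gcongr
  · unfold sF
    have : ⌊y - ((k : ℝ) + 1) * alphaRot⌋ < ⌊z - ((k : ℝ) + 1) * alphaRot⌋ := by
      apply lt_of_lt_of_le (b := m)
      · rw [Int.floor_lt]; linarith
      · rw [Int.le_floor]; linarith
    gcongr

lemma sS_cont {r : ℝ} (h0 : 0 < r) (h1 : r < 1) : Tendsto (sS r) (𝓝 0) (𝓝 (sS r 0)) := by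
  unfold sS
  refine tendsto_tsum_of_dominated_convergence (sB_summable h0 h1 1) ?_ ?_
  · intro k
    unfold sF
    refine Tendsto.const_mul _ ?_
    refine tendsto_const_nhds.congr' ?_
    set x0 : ℝ := 0 - ((k : ℝ) + 1) * alphaRot with hx0
    have hne : (⌊x0⌋ : ℝ) ≠ x0 := by
      have hi : Irrational (((k + 1 : ℕ) : ℝ) * alphaRot) := sA_irr.natCast_mul (by omega)
      have := hi.intCast_add ⌊x0⌋
      intro h
      apply this.ne_int 0
      rw [h, hx0]; push_cast; ring
    have h1 : (⌊x0⌋ : ℝ) < x0 := lt_of_le_of_ne (Int.floor_le _) hne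
    have h2 := Int.lt_floor_add_one x0
    have hc : Tendsto (fun z : ℝ => z - ((k : ℝ) + 1) * alphaRot) (𝓝 0) (𝓝 x0) :=
      (continuous_id.sub continuous_const).tendsto 0
    filter_upwards [hc.eventually (lt_mem_nhds h1), hc.eventually (gt_mem_nhds h2)] with z hz1 hz2
    rw [(Int.floor_eq_iff (a := z - ((k : ℝ) + 1) * alphaRot)).2 ⟨hz1.le, hz2⟩]
  · filter_upwards [Metric.closedBall_mem_nhds (0 : ℝ) one_pos] with z hz k
    exact sF_bound h0 z 1 (by simpa using hz) k

lemma sDelta (b : ℝ) (hb : 1 < b) :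
    fibDelta b = - (1 - 1 / b) ^ 2 * sS (1 / b) 0 := by
  set r := 1 / b with hr
  have h0 : 0 < r := by positivity
  have h1 : r < 1 := by rw [hr, div_lt_one (by linarith)]; exact hb
  have key := sS_rot h0 h1 (0 - alphaRot)
  have hfl : ⌊0 - alphaRot⌋ = -1 := by
    rw [Int.floor_eq_iff]; push_cast; constructor <;> linarith [sA_pos, sA_lt]
  rw [hfl] at key
  have hs : ∑' k : ℕ, (fibWord k : ℝ) * r ^ k = sS r 0 - sS r (0 - alphaRot) := by
    unfold sS
    rw [← (sF_summable h0 h1 _).tsum_sub (sF_summable h0 h1 _)]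
    congr 1; ext k
    have : 0 - alphaRot - ((k : ℝ) + 1) * alphaRot = 0 - ((k : ℝ) + 2) * alphaRot := by ring
    rw [sA_word, sF, sF, this]; push_cast; ring
  unfold fibDelta
  rw [← hr, hs]
  simp only [sub_add_cancel] at key
  push_cast at key
  have : r * sS r (0 - alphaRot) = sS r 0 + 1 := by linarith
  linear_combination (-(1 - r)) * this

theorem stmt6 (b : ℝ) (hb : 1 < b) :
    ∃ h : ℝ → ℝ, ContinuousOn h (Set.Icc 0 1) ∧ MonotoneOn h (Set.Icc 0 1) ∧
      Set.MapsTo h (Set.Icc 0 1) (Set.Icc 0 1) ∧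
      Set.SurjOn h (Set.Icc 0 1) (Set.Icc 0 1) ∧
      ∀ x ∈ Set.Icc (0 : ℝ) 1, h (gmap b x) = Trot (h x) := by
  have hdel := sDelta b hb
  set d := fibDelta b with hd
  set r := 1 / b with hr
  have h0 : 0 < r := by positivity
  have h1 : r < 1 := by rw [hr, div_lt_one (by linarith)]; exact hb
  obtain ⟨P, hP⟩ : ∃ P : ℝ → ℝ, P = fun y => (1 - r) * (sS r y - sS r 0) := ⟨_, rfl⟩
  have hPm : StrictMono P := by
    intro y z hyz
    have := sS_strictMono h0 h1 hyz
    rw [hP]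
    exact mul_lt_mul_of_pos_left (by linarith) (by linarith)
  have hP0 : P 0 = 0 := by simp [hP]
  have hP1 : ∀ y, P (y + 1) = P y + 1 := by
    intro y
    have := sS_add_one h0 h1 y
    simp only [hP]; linarith
  have hPr : ∀ y, P (y + alphaRot) = d + (1 - r) * ⌊y⌋ + r * P y := by
    intro y
    simp only [hP]; rw [sS_rot h0 h1, hdel]; ring
  have hPc : Tendsto P (𝓝 0) (𝓝 0) := by
    have := ((sS_cont h0 h1).sub_const (sS r 0)).const_mul (1 - r)
    rw [hP]; simpa using this
  have hPn : ∀ n : ℕ, P n = n := by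
    intro n
    induction n with
    | zero => simpa using hP0
    | succ n ih => push_cast; rw [hP1, ih]
  have hPn' : ∀ n : ℕ, P (-n) = -n := by
    intro n
    induction n with
    | zero => simpa using hP0
    | succ n ih =>
      have := hP1 (-((n + 1 : ℕ) : ℝ))
      have e : -((n + 1 : ℕ) : ℝ) + 1 = -n := by push_cast; ring
      rw [e, ih] at this
      push_cast at this ⊢; linarith
  obtain ⟨H, hH⟩ : ∃ H : ℝ → ℝ, H = fun x => sSup {y | P y ≤ x} := ⟨_, rfl⟩
  have hne : ∀ x, {y | P y ≤ x}.Nonempty := by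
    intro x
    obtain ⟨n, hn⟩ := exists_nat_ge (-x)
    exact ⟨-n, by simp only [Set.mem_setOf_eq, hPn']; linarith⟩
  have hbd : ∀ x, BddAbove {y | P y ≤ x} := by
    intro x
    obtain ⟨n, hn⟩ := exists_nat_ge x
    refine ⟨n, fun y hy => ?_⟩
    rw [← hPm.le_iff_le, hPn]; exact le_trans hy hn
  have hHlt : ∀ x z, z < H x → P z ≤ x := by
    intro x z hz
    rw [hH] at hz
    obtain ⟨w, hw, hzw⟩ := exists_lt_of_lt_csSup (hne x) hz
    exact (hPm hzw).le.trans hw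
  have hHgt : ∀ x z, H x < z → x ≤ P z := by
    intro x z hz
    by_contra hc
    have : z ≤ H x := by rw [hH]; exact le_csSup (hbd x) (not_le.1 hc).le
    linarith
  have hHeq : ∀ x y, (∀ z < y, P z ≤ x) → (∀ z > y, x ≤ P z) → H x = y := by
    intro x y ha hc
    apply le_antisymm
    · by_contra h
      push Not at h
      obtain ⟨z, hz1, hz2⟩ := exists_between h
      obtain ⟨w, hw1, hw2⟩ := exists_between hz1
      have := hHlt x z hz2
      have := hc w hw1
      have := hPm hw2
      linarith
    · by_contra h
      push Not at h
      obtain ⟨z, hz1, hz2⟩ := exists_between h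
      obtain ⟨w, hw1, hw2⟩ := exists_between hz1
      have := hHgt x w hw1
      have := ha z hz2
      have := hPm hw2
      linarith
  have hHP : ∀ y, H (P y) = y := fun y =>
    hHeq _ _ (fun z hz => (hPm hz).le) (fun z hz => (hPm hz).le)
  have hHm : Monotone H := by
    intro x y hxy
    rw [hH]
    exact csSup_le_csSup (hbd y) (hne x) (fun z hz => le_trans hz hxy)
  have hHc : Continuous H := hHm.continuous_of_surjective (fun y => ⟨P y, hHP y⟩)
  have hH0 : H 0 = 0 := by simpa [hP0] using hHP 0
  have hPone : P 1 = 1 := by simpa using hPn 1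
  have hH1 : H 1 = 1 := by simpa [hPone] using hHP 1
  have hHs : ∀ x, H (x - 1) = H x - 1 := by
    intro x
    apply hHeq
    · intro z hz
      have := hHlt x (z + 1) (by linarith)
      rw [hP1] at this; linarith
    · intro z hz
      have := hHgt x (z + 1) (by linarith)
      rw [hP1] at this; linarith
  have hHlt1 : ∀ u, u < 1 → H u < 1 := by
    intro u hu
    by_contra hc
    push Not at hc
    have hev : ∀ᶠ z in 𝓝[<] (0 : ℝ), P z ≤ u - 1 := by
      filter_upwards [self_mem_nhdsWithin] with z hz
      have hz : z < 0 := hz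
      have := hHlt u (z + 1) (by linarith)
      rw [hP1] at this; linarith
    have := le_of_tendsto (hPc.mono_left nhdsWithin_le_nhds) hev
    linarith
  have hHI : ∀ x ∈ Set.Icc (0 : ℝ) 1, H x ∈ Set.Icc (0 : ℝ) 1 := by
    intro x hx
    exact ⟨hH0 ▸ hHm hx.1, hH1 ▸ hHm hx.2⟩
  have hrot : ∀ x ∈ Set.Icc (0 : ℝ) 1, H (x / b + d) = H x + alphaRot := by
    intro x hx
    have hxI := hHI x hx
    have hxr : x / b = r * x := by rw [hr]; ring
    rw [hxr]
    apply hHeq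
    · intro z hz
      have e := hPr (z - alphaRot)
      have hw := hHlt x (z - alphaRot) (by linarith)
      have hf : ⌊z - alphaRot⌋ ≤ 0 := by
        have : ⌊z - alphaRot⌋ < 1 := by rw [Int.floor_lt]; push_cast; linarith [hxI.2]
        omega
      have hf' : (⌊z - alphaRot⌋ : ℝ) ≤ 0 := by exact_mod_cast hf
      rw [sub_add_cancel] at e
      rw [e]
      nlinarith
    · intro z hz
      have e := hPr (z - alphaRot)
      have hw := hHgt x (z - alphaRot) (by linarith)
      have hf : 0 ≤ ⌊z - alphaRot⌋ := Int.floor_nonneg.2 (by linarith [hxI.1])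
      have hf' : (0 : ℝ) ≤ (⌊z - alphaRot⌋ : ℝ) := by exact_mod_cast hf
      rw [sub_add_cancel] at e
      rw [e]
      nlinarith
  refine ⟨H, hHc.continuousOn, hHm.monotoneOn _, hHI, ?_, ?_⟩
  · intro y hy
    refine ⟨P y, ⟨?_, ?_⟩, hHP y⟩
    · rw [← hP0]; exact hPm.monotone hy.1
    · rw [← hPone]; exact hPm.monotone hy.2
  · intro x hx
    have hr1 := hrot x hx
    have hb0 : 0 < b := by linarith
    have hiff : x < b * (1 - d) ↔ x / b + d < 1 := by
      rw [← lt_sub_iff_add_lt, div_lt_iff₀ hb0, mul_comm]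
    unfold gmap Trot
    rw [← hd]
    by_cases hc : x < b * (1 - d)
    · have h2 := hHlt1 _ (hiff.1 hc)
      rw [if_pos hc, if_pos (by linarith), hr1]
    · have h2 : 1 ≤ x / b + d := by rw [hiff] at hc; linarith
      have h3 := hHm h2
      rw [if_neg hc, if_neg (by linarith), hHs, hr1]
end

section
/- Let b > 1 and let δ be defined from the Fibonacci word. Let g : [0,1] → [0,1] be defined by g(x) = x/b + δ for x ∈ [0, b(1−δ)) and g(x) = x/b + δ − 1 for x ∈ [b(1−δ), 1]. Then there exists a Cantor set C ⊂ [0,1] such that ω_g(x) = C for every x ∈ [0,1]. -/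
open Filter Topology

noncomputable def al : ℝ := 2 - phiGolden

lemma al_irr : Irrational al := by
  have h : Irrational ((2:ℕ) - Real.goldenRatio) := Real.goldenRatio_irrational.natCast_sub 2
  simpa [al, phiGolden, Real.goldenRatio] using h

lemma al_pos : 0 < al := by
  have h := Real.goldenRatio_lt_two
  unfold Real.goldenRatio at h
  unfold al phiGolden; linarith

lemma al_lt : al < 1 := by
  have h := Real.one_lt_goldenRatio
  unfold Real.goldenRatio at h
  unfold al phiGolden; linarith

lemma al_dense0 (y u v : ℝ) (h : u < v) : ∃ n : ℕ, ∃ m : ℤ, u < y + n * al - m ∧ y + n * al - m < v := by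
  have h1 : DenseRange (· • (al : AddCircle (1:ℝ)) : ℤ → AddCircle (1:ℝ)) := by
    rw [AddCircle.denseRange_zsmul_coe_iff]; simpa using al_irr
  have : Fact ((0:ℝ) < 1) := ⟨one_pos⟩
  rw [denseRange_zsmul_iff_nsmul] at h1
  have hop : IsOpen ((fun x : ℝ => (x : AddCircle (1:ℝ))) '' Set.Ioo (u - y) (v - y)) :=
    QuotientAddGroup.isOpenMap_coe _ isOpen_Ioo
  obtain ⟨n, hn⟩ := h1.exists_mem_open hop (Set.Nonempty.image _ (by simpa using h))
  obtain ⟨t, ht, hte⟩ := hn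
  have : (t : AddCircle (1:ℝ)) = ((n * al : ℝ) : AddCircle (1:ℝ)) := by
    rw [← nsmul_eq_mul]; exact hte
  have h3 : ((n * al - t : ℝ) : AddCircle (1:ℝ)) = 0 := by
    rw [AddCircle.coe_sub, this, sub_self]
  obtain ⟨m, hm⟩ := (AddCircle.coe_eq_zero_iff (1:ℝ)).1 h3
  simp only [zsmul_eq_mul, mul_one] at hm
  obtain ⟨ha, hb⟩ := ht
  exact ⟨n, m, by linarith, by linarith⟩

lemma al_dense (N : ℕ) (y u v : ℝ) (h : u < v) :
    ∃ n : ℕ, N ≤ n ∧ ∃ m : ℤ, u < y + n * al - m ∧ y + n * al - m < v := by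
  obtain ⟨n, m, h1, h2⟩ := al_dense0 (y + N * al) u v h
  refine ⟨N + n, by omega, m, ?_, ?_⟩ <;> push_cast <;> linarith

noncomputable def SS (l y : ℝ) : ℝ := ∑' j : ℕ, l ^ j * (⌊y - (j + 1) * al⌋ : ℝ)

lemma fl_bound (y M : ℝ) (j : ℕ) (hM : |y| ≤ M) : |(⌊y - (j + 1) * al⌋ : ℝ)| ≤ M + 2 + j := by
  have h1 := Int.floor_le (y - (j + 1) * al)
  have h2 := Int.lt_floor_add_one (y - (j + 1) * al)
  have h3 := abs_le.1 hM
  have h4 := al_pos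
  have h5 := al_lt
  have h6 : (j + 1 : ℝ) * al ≤ j + 1 := by nlinarith [(Nat.cast_nonneg j : (0:ℝ) ≤ j)]
  have h7 : 0 ≤ (j + 1 : ℝ) * al := by positivity
  have := (Nat.cast_nonneg j : (0:ℝ) ≤ j)
  rw [abs_le]; constructor <;> linarith

section
variable {l : ℝ} (hl0 : 0 < l) (hl1 : l < 1)
include hl0 hl1

lemma bd_sum (M : ℝ) : Summable (fun j : ℕ => l ^ j * (M + j)) := by
  have h1 : Summable (fun j : ℕ => M * l ^ j) := (summable_geometric_of_lt_one hl0.le hl1).mul_left M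
  have h2 := summable_pow_mul_geometric_of_norm_lt_one (R := ℝ) 1 (r := l)
    (by rw [Real.norm_eq_abs, abs_of_pos hl0]; exact hl1)
  refine (h1.add h2).congr fun j => ?_
  simp; ring

lemma SS_sum (y : ℝ) : Summable (fun j : ℕ => l ^ j * (⌊y - (j + 1) * al⌋ : ℝ)) := by
  refine Summable.of_norm_bounded (bd_sum hl0 hl1 (|y| + 2)) fun j => ?_
  rw [norm_mul, norm_pow, Real.norm_eq_abs, abs_of_pos hl0, Real.norm_eq_abs]
  gcongr
  exact fl_bound y _ j le_rfl

lemma SS_add (y : ℝ) : SS l (y + al) = ⌊y⌋ + l * SS l y := by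
  unfold SS
  rw [(SS_sum hl0 hl1 (y + al)).tsum_eq_zero_add, ← tsum_mul_left]
  congr 1
  · simp
  · refine tsum_congr fun j => ?_
    rw [pow_succ]
    have : y + al - (((j + 1 : ℕ) : ℝ) + 1) * al = y - (j + 1) * al := by push_cast; ring
    rw [this]; ring

lemma SS_mono : Monotone (SS l) := by
  intro u v h
  refine Summable.tsum_le_tsum (fun j => ?_) (SS_sum hl0 hl1 u) (SS_sum hl0 hl1 v)
  gcongr

lemma SS_int (y : ℝ) (m : ℤ) : SS l (y + m) = SS l y + m / (1 - l) := by
  unfold SS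
  have h : (m : ℝ) / (1 - l) = ∑' j : ℕ, l ^ j * (m:ℝ) := by
    rw [tsum_mul_right, tsum_geometric_of_lt_one hl0.le hl1]; field_simp
  rw [h, ← (SS_sum hl0 hl1 y).tsum_add ((summable_geometric_of_lt_one hl0.le hl1).mul_right _)]
  refine tsum_congr fun j => ?_
  have : y + m - (j + 1) * al = y - (j + 1) * al + m := by ring
  rw [this, Int.floor_add_intCast]; push_cast; ring

lemma SS_jump (u v : ℝ) (h : u < v) : ∃ w, u < w ∧ w < v ∧ ∃ e > 0, ∀ t < w, SS l t + e ≤ SS l w := by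
  obtain ⟨n, hn, m, h1, h2⟩ := al_dense 1 0 u v h
  obtain ⟨k, rfl⟩ : ∃ k, n = k + 1 := ⟨n - 1, by omega⟩
  refine ⟨_, h1, h2, l ^ k, by positivity, fun t ht => ?_⟩
  unfold SS
  have hs : HasSum (fun j : ℕ => if j = k then l ^ k else 0) (l ^ k) := hasSum_ite_eq k (l ^ k)
  refine le_of_eq_of_le (congrArg _ hs.tsum_eq.symm) ?_
  rw [← (SS_sum hl0 hl1 t).tsum_add hs.summable]
  refine Summable.tsum_le_tsum (fun j => ?_) ((SS_sum hl0 hl1 t).add hs.summable) (SS_sum hl0 hl1 _)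
  split_ifs with hj
  · subst hj
    have e1 : 0 + ((j + 1 : ℕ) : ℝ) * al - m - (j + 1) * al = ((-m : ℤ) : ℝ) := by push_cast; ring
    have e2 : ⌊t - (j + 1) * al⌋ < -m := by
      rw [Int.floor_lt, ← e1]; linarith
    rw [e1, Int.floor_intCast]
    have e3 : (⌊t - (j + 1) * al⌋ : ℝ) + 1 ≤ ((-m : ℤ) : ℝ) := by exact_mod_cast e2
    have := mul_le_mul_of_nonneg_left e3 (pow_pos hl0 j).le
    linarith
  · rw [add_zero]; gcongr

lemma SS_right (y : ℝ) : Tendsto (SS l) (𝓝[>] y) (𝓝 (SS l y)) := by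
  unfold SS
  refine tendsto_tsum_of_dominated_convergence (bd_sum hl0 hl1 (|y| + 1 + 2)) (fun j => ?_) ?_
  · refine Tendsto.const_mul _ ?_
    have h1 : Tendsto (fun t => t - (j + 1) * al) (𝓝[>] y) (𝓝[≥] (y - (j + 1) * al)) := by
      refine tendsto_nhdsWithin_iff.2 ⟨?_, ?_⟩
      · exact ((continuous_id.sub continuous_const).tendsto y).mono_left nhdsWithin_le_nhds
      · filter_upwards [self_mem_nhdsWithin] with t ht
        simp only [Set.mem_Ioi, Set.mem_Ici] at *
        linarith
    have h2 := (tendsto_floor_right_pure_floor (y - (j + 1) * al)).comp h1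
    have h3 := (tendsto_pure_pure (fun z : ℤ => (z : ℝ)) _).comp h2
    exact h3.mono_right (pure_le_nhds _)
  · have : ∀ᶠ t in 𝓝[>] y, t < y + 1 :=
      nhdsWithin_le_nhds (eventually_lt_nhds (by linarith))
    filter_upwards [self_mem_nhdsWithin, this] with t ht ht2 j
    rw [norm_mul, norm_pow, Real.norm_eq_abs, abs_of_pos hl0, Real.norm_eq_abs]
    gcongr
    refine fl_bound t _ j ?_
    simp only [Set.mem_Ioi] at ht
    rw [abs_le]; constructor <;> cases abs_cases y <;> linarith

lemma SS_zero_le : SS l 0 ≤ - (1 / (1 - l)) := by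
  have h : - (1 / (1 - l)) = ∑' j : ℕ, l ^ j * (-1:ℝ) := by
    rw [tsum_mul_right, tsum_geometric_of_lt_one hl0.le hl1]; field_simp
  rw [h]; unfold SS
  refine Summable.tsum_le_tsum (fun j => ?_) (SS_sum hl0 hl1 0)
    ((summable_geometric_of_lt_one hl0.le hl1).mul_right _)
  gcongr
  have : ⌊(0:ℝ) - (j + 1) * al⌋ < 0 := by
    rw [Int.floor_lt]
    have : 0 < (j + 1 : ℝ) * al := by have := al_pos; positivity
    simpa using this
  have h2 : ⌊(0:ℝ) - (j + 1) * al⌋ ≤ -1 := by omega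
  exact_mod_cast h2

lemma fib_tsum : l * ∑' k : ℕ, (fibWord k : ℝ) * l ^ k = l * SS l 0 - SS l 0 - 1 := by
  have h1 := SS_sum hl0 hl1 0
  have h2 := SS_sum hl0 hl1 (-al)
  have e : SS l 0 = -1 + l * SS l (-al) := by
    have := SS_add hl0 hl1 (-al)
    rw [neg_add_cancel] at this
    rw [this]
    have : ⌊-al⌋ = -1 := by
      rw [Int.floor_eq_iff]; have := al_pos; have := al_lt; push_cast; constructor <;> linarith
    rw [this]; norm_num
  have e2 : ∑' k : ℕ, (fibWord k : ℝ) * l ^ k = SS l 0 - SS l (-al) := by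
    unfold SS
    rw [← h1.tsum_sub h2]
    refine tsum_congr fun k => ?_
    have : fibWord k = ⌊(0:ℝ) - (k + 1) * al⌋ - ⌊-al - (k + 1) * al⌋ := by
      unfold fibWord
      have a1 : ((k:ℝ) + 1) * phiGolden = (0 - (k + 1) * al) + ((2 * (k + 1) : ℤ) : ℝ) := by
        unfold al; push_cast; ring
      have a2 : ((k:ℝ) + 2) * phiGolden = (-al - (k + 1) * al) + ((2 * (k + 2) : ℤ) : ℝ) := by
        unfold al; push_cast; ring
      rw [a1, a2, Int.floor_add_intCast, Int.floor_add_intCast]; ring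
    rw [this]; push_cast; ring
  rw [e2]; linarith

end

section
variable {F G : ℝ → ℝ} 

def RR (F : ℝ → ℝ) (x y : ℝ) : Prop := (∀ t < y, F t ≤ x) ∧ (∀ t, y < t → x ≤ F t)

lemma RR_exists (hF : StrictMono F) (h0 : F 0 = 0) (h1 : F 1 = 1) (x : ℝ) (hx0 : 0 ≤ x) (hx1 : x < 1) :
    ∃ y, RR F x y := by
  have hne : {t | F t ≤ x}.Nonempty := ⟨0, by simpa [h0] using hx0⟩
  have hbd : BddAbove {t | F t ≤ x} := ⟨1, fun t ht => by
    by_contra hh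
    push Not at hh
    have := hF hh
    simp only [Set.mem_ofPred_eq] at ht
    linarith⟩
  refine ⟨sSup {t | F t ≤ x}, fun t ht => ?_, fun t ht => ?_⟩
  · obtain ⟨s, hs, hts⟩ := exists_lt_of_lt_csSup hne ht
    exact (hF hts).le.trans hs
  · by_contra hh
    push Not at hh
    exact absurd (le_csSup hbd (show t ∈ {t | F t ≤ x} from hh.le)) (not_le.2 ht)

lemma RR_iter (hG : Monotone G) (hFG : ∀ y, F (y + al) = G (F y)) (x y : ℝ) (h : RR F x y) (n : ℕ) :
    RR F (G^[n] x) (y + n * al) := by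
  induction n with
  | zero => simpa using h
  | succ n ih =>
    rw [Function.iterate_succ_apply']
    refine ⟨fun t ht => ?_, fun t ht => ?_⟩
    · have := hG (ih.1 (t - al) (by push_cast at ht; linarith))
      rwa [← hFG, sub_add_cancel] at this
    · have := hG (ih.2 (t - al) (by push_cast at ht; linarith))
      rwa [← hFG, sub_add_cancel] at this

lemma RR_int (hF1 : ∀ y (m : ℤ), F (y + m) = F y + m) (x y : ℝ) (h : RR F x y) (m : ℤ) :
    RR F (x - m) (y - m) := by
  refine ⟨fun t ht => ?_, fun t ht => ?_⟩
  · have := h.1 (t + m) (by linarith)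
    rw [hF1] at this; linarith
  · have := h.2 (t + m) (by linarith)
    rw [hF1] at this; linarith

lemma cantor_C (hF : StrictMono F) (h0 : F 0 = 0) (h1 : F 1 = 1)
    (hr : ∀ y, Tendsto F (𝓝[>] y) (𝓝 (F y)))
    (hj : ∀ u v, u < v → ∃ w, u < w ∧ w < v ∧ ∃ e > 0, ∀ t < w, F t + e ≤ F w) :
    IsCantorSet (closure (F '' Set.Ico 0 1)) ∧ closure (F '' Set.Ico 0 1) ⊆ Set.Icc 0 1 := by
  have hsub : closure (F '' Set.Ico 0 1) ⊆ Set.Icc 0 1 := by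
    refine closure_minimal ?_ isClosed_Icc
    rintro _ ⟨t, ht, rfl⟩
    exact ⟨h0 ▸ hF.monotone ht.1, h1 ▸ hF.monotone ht.2.le⟩
  refine ⟨⟨?_, ?_, ?_, ?_⟩, hsub⟩
  · exact ⟨F 0, subset_closure ⟨0, by simp, rfl⟩⟩
  · exact isCompact_Icc.of_isClosed_subset isClosed_closure hsub
  · refine Preperfect.perfect_closure ?_
    rintro _ ⟨z, hz, rfl⟩
    rw [accPt_iff_nhds]
    intro U hU
    have e1 := (hr z).eventually hU
    have e2 : ∀ᶠ t in 𝓝[>] z, t < 1 := nhdsWithin_le_nhds (eventually_lt_nhds hz.2)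
    obtain ⟨t, ht1, ht2, ht3⟩ := (e1.and (e2.and self_mem_nhdsWithin)).exists
    have ht3 : z < t := ht3
    exact ⟨F t, ⟨ht1, t, ⟨hz.1.trans ht3.le, ht2⟩, rfl⟩, (hF ht3).ne'⟩
  · rw [isClosed_closure.isNowhereDense_iff, Set.eq_empty_iff_forall_notMem]
    intro p hp
    obtain ⟨r, hr0, hball⟩ := Metric.isOpen_iff.1 isOpen_interior p hp
    have hball := hball.trans interior_subset
    have key : ∀ a c, p - r < a → a < c → c < p + r → ∃ z ∈ Set.Ico (0:ℝ) 1, a < F z ∧ F z < c := by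
      intro a c ha hac hc
      have hm : (a + c) / 2 ∈ closure (F '' Set.Ico 0 1) := hball (by
        rw [Real.ball_eq_Ioo]; constructor <;> linarith)
      obtain ⟨_, ⟨h2, h3⟩, z, hz, rfl⟩ := mem_closure_iff.1 hm (Set.Ioo a c) isOpen_Ioo
        ⟨by linarith, by linarith⟩
      exact ⟨z, hz, h2, h3⟩
    obtain ⟨z, hz, hz1, hz2⟩ := key (p - r / 2) p (by linarith) (by linarith) (by linarith)
    obtain ⟨z', hz', hz'1, hz'2⟩ := key p (p + r / 2) (by linarith) (by linarith) (by linarith)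
    obtain ⟨w, hw1, hw2, e, he, hjw⟩ := hj z z' (hF.lt_iff_lt.1 (by linarith))
    have k1 := hF hw2
    have k2 := hjw z hw1
    obtain ⟨t, ht, ht1, ht2⟩ := key (F w - e) (F w) (by linarith) (by linarith) (by linarith)
    have := hjw t (hF.lt_iff_lt.1 ht2)
    linarith

lemma omega_C {g : ℝ → ℝ} (hF : StrictMono F) (h0 : F 0 = 0) (h1 : F 1 = 1)
    (hF1 : ∀ y (m : ℤ), F (y + m) = F y + m)
    (hr : ∀ y, Tendsto F (𝓝[>] y) (𝓝 (F y)))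
    (hG : Monotone G) (hFG : ∀ y, F (y + al) = G (F y))
    (x : ℝ) (hx0 : 0 ≤ x) (hx1 : x < 1) (hg : ∀ n, g^[n] x = Int.fract (G^[n] x)) :
    omegaLim g x = closure (F '' Set.Ico 0 1) := by
  obtain ⟨y, hy⟩ := RR_exists hF h0 h1 x hx0 hx1
  have hyn := RR_iter hG hFG x y hy
  apply Set.Subset.antisymm
  · rintro p ⟨n, hn, hlim⟩
    by_contra hp
    obtain ⟨r, hr0, hball⟩ := Metric.isOpen_iff.1 isClosed_closure.isOpen_compl p hp
    obtain ⟨K, hK⟩ := eventually_atTop.1 (hlim.eventually (Metric.ball_mem_nhds p hr0))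
    have key : ∀ i j : ℕ, g^[i] x ∈ Metric.ball p r → g^[j] x ∈ Metric.ball p r →
        ¬ (y + i * al - ⌊G^[i] x⌋ < y + j * al - ⌊G^[j] x⌋) := by
      intro i j hi hj hlt
      have Ri := RR_int hF1 _ _ (hyn i) ⌊G^[i] x⌋
      have Rj := RR_int hF1 _ _ (hyn j) ⌊G^[j] x⌋
      change RR F (Int.fract (G^[i] x)) _ at Ri
      change RR F (Int.fract (G^[j] x)) _ at Rj
      rw [hg, Real.ball_eq_Ioo] at hi hj
      obtain ⟨w, hw1, hw2⟩ := exists_between hlt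
      have a1 := Ri.2 w hw1
      have a2 := Rj.1 w hw2
      have fi := Int.fract_nonneg (G^[i] x)
      have fj := Int.fract_lt_one (G^[j] x)
      obtain ⟨w', hw'1, hw'2⟩ := exists_between hw1
      have a3 := Ri.2 w' hw'1
      have hw0 : 0 ≤ w := by
        apply le_of_lt; rw [← hF.lt_iff_lt, h0]; have := hF hw'2; linarith
      have hw1 : w < 1 := by rw [← hF.lt_iff_lt, h1]; linarith
      refine hball (a := F w) ?_ (subset_closure ⟨w, ⟨hw0, hw1⟩, rfl⟩)
      rw [Real.ball_eq_Ioo]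
      exact ⟨by linarith [hi.1], by linarith [hj.2]⟩
    have hlt : n K < n (K + 1) := hn (Nat.lt_succ_self K)
    have b1 := key _ _ (hK K le_rfl) (hK (K + 1) (by omega))
    have b2 := key _ _ (hK (K + 1) (by omega)) (hK K le_rfl)
    have heq := le_antisymm (not_lt.1 b1) (not_lt.1 b2)
    have hd : ((n (K + 1) : ℤ) - n K : ℤ) ≠ 0 := by omega
    apply (al_irr.intCast_mul hd).ne_int (⌊G^[n (K+1)] x⌋ - ⌊G^[n K] x⌋)
    push_cast
    linarith
  · intro p hp
    have key : ∀ (N : ℕ) (e : ℝ), 0 < e → ∃ n, N ≤ n ∧ |g^[n] x - p| < e := by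
      intro N e he
      obtain ⟨_, ⟨z, hz, rfl⟩, hd⟩ := Metric.mem_closure_iff.1 hp (e / 2) (by linarith)
      rw [Real.dist_eq, abs_lt] at hd
      have e1 := (hr z).eventually (eventually_lt_nhds (show F z < F z + e / 2 by linarith))
      have e2 : ∀ᶠ t in 𝓝[>] z, t < 1 := nhdsWithin_le_nhds (eventually_lt_nhds hz.2)
      obtain ⟨t, ht1, ht2, ht3⟩ := (e1.and (e2.and self_mem_nhdsWithin)).exists
      have ht3 : z < t := ht3
      obtain ⟨n, hn, m, hm1, hm2⟩ := al_dense N y z t ht3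
      have R := RR_int hF1 _ _ (hyn n) m
      have c1 := R.1 z hm1
      have c2 := R.2 t hm2
      have c3 : 0 ≤ F z := h0 ▸ hF.monotone hz.1
      have c4 : F t < 1 := h1 ▸ hF ht2
      have hfl : ⌊G^[n] x⌋ = m := by
        rw [Int.floor_eq_iff]; constructor <;> linarith
      refine ⟨n, hn, ?_⟩
      rw [hg, Int.fract, hfl, abs_lt]
      constructor <;> linarith [hd.1, hd.2]
    have key2 : ∀ k : ℕ, ∃ᶠ n in atTop, |g^[n] x - p| < 1 / ((k : ℝ) + 1) := by
      intro k
      rw [frequently_atTop]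
      intro N
      obtain ⟨n, h⟩ := key N (1 / ((k:ℝ) + 1)) (by positivity)
      exact ⟨n, h⟩
    obtain ⟨n, hn, hn2⟩ := extraction_forall_of_frequently key2
    refine ⟨n, hn, ?_⟩
    rw [tendsto_iff_dist_tendsto_zero]
    refine squeeze_zero (fun _ => dist_nonneg) (fun k => ?_) tendsto_one_div_add_atTop_nhds_zero_nat
    rw [Real.dist_eq]; exact (hn2 k).le

end

lemma omega_shift (g : ℝ → ℝ) (x : ℝ) : omegaLim g (g x) = omegaLim g x := by
  ext p
  constructor
  · rintro ⟨n, hn, hl⟩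
    refine ⟨fun k => n k + 1, fun a c h => Nat.succ_lt_succ (hn h), ?_⟩
    simpa [Function.iterate_succ_apply] using hl
  · rintro ⟨n, hn, hl⟩
    have hpos : ∀ k, 1 ≤ n (k + 1) := fun k => by
      have := hn (Nat.lt_succ_self k); simp only [Nat.succ_eq_add_one] at this; omega
    refine ⟨fun k => n (k + 1) - 1, fun a c h => ?_, ?_⟩
    · have := hn (Nat.succ_lt_succ h); have := hpos a; have := hpos c
      simp only [Nat.succ_eq_add_one] at *; omega
    · have := hl.comp (tendsto_add_atTop_nat 1)
      refine this.congr fun k => ?_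
      simp only [Function.comp]
      rw [← Function.iterate_succ_apply]
      congr 1
      have := hpos k
      congr 1; omega

theorem stmt7 (b : ℝ) (hb : 1 < b) :
    ∃ C : Set ℝ, IsCantorSet C ∧ C ⊆ Set.Icc 0 1 ∧
      ∀ x ∈ Set.Icc (0 : ℝ) 1, omegaLim (gmap b) x = C := by
  obtain ⟨l, hl⟩ : ∃ l, l = 1 / b := ⟨_, rfl⟩
  have hb0 : 0 < b := by linarith
  have hl0 : 0 < l := by rw [hl]; positivity
  have hl1 : l < 1 := by rw [hl, div_lt_one hb0]; exact hb
  have hbl : b * l = 1 := by rw [hl]; field_simp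
  obtain ⟨d, hd⟩ : ∃ d, d = fibDelta b := ⟨_, rfl⟩
  have hd2 : d = - (1 - l) ^ 2 * SS l 0 := by
    have := fib_tsum hl0 hl1
    rw [hd, fibDelta, ← hl]
    linear_combination (1 - l) * this
  obtain ⟨F, hFd⟩ : ∃ F : ℝ → ℝ, ∀ y, F y = (1 - l) * (SS l y - SS l 0) := ⟨_, fun _ => rfl⟩
  obtain ⟨G, hGd⟩ : ∃ G : ℝ → ℝ, ∀ x, G x = l * x + (1 - l) * ⌊x⌋ + d := ⟨_, fun _ => rfl⟩
  have hl2 : 0 < 1 - l := by linarith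
  have hj : ∀ u v, u < v → ∃ w, u < w ∧ w < v ∧ ∃ e > 0, ∀ t < w, F t + e ≤ F w := by
    intro u v huv
    obtain ⟨w, h1, h2, e, he, h⟩ := SS_jump hl0 hl1 u v huv
    refine ⟨w, h1, h2, (1 - l) * e, by positivity, fun t ht => ?_⟩
    have := mul_le_mul_of_nonneg_left (h t ht) hl2.le
    rw [hFd, hFd]; linarith
  have hmono : Monotone F := by
    intro u v h
    have := mul_le_mul_of_nonneg_left (SS_mono hl0 hl1 h) hl2.le
    rw [hFd, hFd]; linarith
  have hF : StrictMono F := by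
    intro u v h
    obtain ⟨w, h1, h2, e, he, hw⟩ := hj u v h
    have := hw u h1
    have := hmono h2.le
    linarith
  have h0 : F 0 = 0 := by rw [hFd]; ring
  have hF1 : ∀ y (m : ℤ), F (y + m) = F y + m := by
    intro y m
    rw [hFd, hFd, SS_int hl0 hl1]; field_simp; ring
  have h1 : F 1 = 1 := by simpa [h0] using hF1 0 1
  have hr : ∀ y, Tendsto F (𝓝[>] y) (𝓝 (F y)) := by
    intro y
    have : F = fun y => (1 - l) * (SS l y - SS l 0) := funext hFd
    rw [this]
    exact ((SS_right hl0 hl1 y).sub_const _).const_mul _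
  have hG : Monotone G := by
    intro u v h
    rw [hGd, hGd]
    have : (⌊u⌋ : ℝ) ≤ ⌊v⌋ := by exact_mod_cast Int.floor_mono h
    gcongr
  have hffl : ∀ y, ⌊F y⌋ = ⌊y⌋ := by
    intro y
    have a := hF1 0 ⌊y⌋
    have a' := hF1 0 (⌊y⌋ + 1)
    rw [zero_add, h0] at a a'
    rw [Int.floor_eq_iff]
    constructor
    · have := hmono (Int.floor_le y); linarith
    · have := hF (show y < ((⌊y⌋ + 1 : ℤ) : ℝ) by push_cast; exact Int.lt_floor_add_one y)
      push_cast at a' this; linarith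
  have hFG : ∀ y, F (y + al) = G (F y) := by
    intro y
    rw [hGd, hffl, hFd, hFd, SS_add hl0 hl1, hd2]; ring
  have hdF : F al = d := by
    have := hFG 0
    rw [zero_add, h0, hGd] at this; simpa using this
  have hd0 : 0 < d := by rw [← hdF, ← h0]; exact hF al_pos
  have hd1 : d < 1 := by rw [← hdF, ← h1]; exact hF al_lt
  have hd3 : 1 - l ≤ d := by
    have := mul_le_mul_of_nonneg_left (SS_zero_le hl0 hl1) (sq_nonneg (1 - l))
    have e : (1 - l) ^ 2 * (- (1 / (1 - l))) = - (1 - l) := by field_simp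
    rw [e] at this; rw [hd2]; linarith
  have hgm : ∀ x, gmap b x = if l * x < 1 - d then l * x + d else l * x + d - 1 := by
    intro x
    have e : x / b = l * x := by rw [hl]; ring
    have e2 : x < b * (1 - d) ↔ l * x < 1 - d := by
      rw [← e, div_lt_iff₀ hb0, mul_comm]
    rw [gmap, ← hd, e]; simp only [e2]
  have hgf : ∀ x, 0 ≤ x → x < 1 → gmap b x = Int.fract (G x) := by
    intro x hx0 hx1
    have hfx : ⌊x⌋ = 0 := by rw [Int.floor_eq_iff]; simp [hx0, hx1]
    have hlx : l * x < 1 := by nlinarith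
    have hlx0 : 0 ≤ l * x := by positivity
    rw [hgm, hGd, hfx]
    symm
    rw [Int.fract_eq_iff]
    split_ifs with h
    · exact ⟨by linarith, by linarith, 0, by push_cast; ring⟩
    · exact ⟨by linarith, by linarith, 1, by push_cast; ring⟩
  have hG1 : ∀ x (m : ℤ), G (x + m) = G x + m := by
    intro x m
    rw [hGd, hGd, Int.floor_add_intCast]; push_cast; ring
  have hit : ∀ x, 0 ≤ x → x < 1 → ∀ n, (gmap b)^[n] x = Int.fract (G^[n] x) := by
    intro x hx0 hx1 n
    induction n with
    | zero => simp only [Function.iterate_zero, id]; exact (Int.fract_eq_self.2 ⟨hx0, hx1⟩).symm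
    | succ n ih =>
      rw [Function.iterate_succ_apply', Function.iterate_succ_apply', ih,
        hgf _ (Int.fract_nonneg _) (Int.fract_lt_one _)]
      nth_rw 2 [← Int.fract_add_floor (G^[n] x)]
      rw [hG1, Int.fract_add_intCast]
  obtain ⟨hC1, hC2⟩ := cantor_C hF h0 h1 hr hj
  have main : ∀ x, 0 ≤ x → x < 1 → omegaLim (gmap b) x = closure (F '' Set.Ico 0 1) :=
    fun x hx0 hx1 => omega_C hF h0 h1 hF1 hr hG hFG x hx0 hx1 (hit x hx0 hx1)
  refine ⟨_, hC1, hC2, fun x hx => ?_⟩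
  rcases hx.2.lt_or_eq with h | rfl
  · exact main x hx.1 h
  · rw [← omega_shift]
    have e : gmap b 1 = l + d - 1 := by
      rw [hgm, if_neg (by linarith), mul_one]
    rw [e]
    exact main _ (by linarith) (by linarith)
end

section
/- Let b > 1, let δ be defined from the Fibonacci word, let ρ = (500b/(b−1))·(b(1−δ)+1), and let f : ℝ → ℝ be defined by f(x) = x/b + 1000 if x < ρ and f(x) = x/b + 500 if x ≥ ρ. Let K = [500b(2−δ)/(b−1), 500b(3−δ−1/b)/(b−1)] and let T : [0,1] → [0,1] be the rotation by α = (3−√5)/2. Then f(K) ⊆ K and the restriction f|_K is topologically semiconjugate to T: there exists a continuous, nondecreasing, surjective map h : K → [0,1] such that h(f(x)) = T(h(x)) for all x ∈ K. -/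
open Filter Topology

namespace S9

noncomputable def F (β δ : ℝ) (t : ℝ) : ℝ :=
  ∑' k : ℕ, β ^ k * (δ + (1 - β) * (⌊t - ((k : ℝ) + 1) * alphaRot⌋ : ℝ))

lemma sq5 : 2 < Real.sqrt 5 ∧ Real.sqrt 5 < 3 :=
  ⟨by rw [Real.lt_sqrt] <;> norm_num, by rw [Real.sqrt_lt'] <;> norm_num⟩

lemma alpha_pos : 0 < alphaRot := by
  have := sq5; unfold alphaRot; linarith

lemma alpha_lt : alphaRot < 1 := by
  have := sq5; unfold alphaRot; linarith

lemma alpha_irr : Irrational alphaRot := by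
  have h : Irrational (Real.sqrt 5) := by
    have := Nat.Prime.irrational_sqrt (p := 5) (by norm_num)
    exact_mod_cast this
  have h2 := (h.ratCast_sub 3).div_natCast (m := 2) (by norm_num)
  unfold alphaRot
  exact_mod_cast h2

lemma floor_bound (t : ℝ) (k : ℕ) : |(⌊t - ((k : ℝ) + 1) * alphaRot⌋ : ℝ)| ≤ |t| + k + 2 := by
  have h1 := Int.floor_le (t - ((k : ℝ) + 1) * alphaRot)
  have h2 := Int.lt_floor_add_one (t - ((k : ℝ) + 1) * alphaRot)
  have h3 := alpha_pos
  have h4 := alpha_lt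
  have hk : (0 : ℝ) ≤ k := Nat.cast_nonneg k
  have h5 : ((k : ℝ) + 1) * alphaRot ≤ k + 1 := by nlinarith
  have h6 : 0 ≤ ((k : ℝ) + 1) * alphaRot := by positivity
  have h7 := le_abs_self t
  have h8 := neg_abs_le t
  rw [abs_le]; constructor <;> linarith


lemma sum_bound {β : ℝ} (h0 : 0 < β) (h1 : β < 1) (C : ℝ) : Summable (fun k : ℕ => β ^ k * (C + k)) := by
  have a := (summable_geometric_of_lt_one h0.le h1).mul_left C
  have b := summable_pow_mul_geometric_of_norm_lt_one 1 (r := β)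
    (by rw [Real.norm_eq_abs, abs_of_pos h0]; exact h1)
  refine (a.add b).congr ?_
  intro k; simp; ring

lemma term_bound {β : ℝ} (h0 : 0 < β) (h1 : β < 1) (δ t : ℝ) (k : ℕ) :
    ‖β ^ k * (δ + (1 - β) * (⌊t - ((k : ℝ) + 1) * alphaRot⌋ : ℝ))‖ ≤
      β ^ k * ((|δ| + |t| + 2) + k) := by
  rw [norm_mul, Real.norm_eq_abs, Real.norm_eq_abs, abs_of_pos (pow_pos h0 k)]
  apply mul_le_mul_of_nonneg_left _ (pow_pos h0 k).le
  have := floor_bound t k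
  calc _ ≤ |δ| + |(1 - β) * (⌊t - ((k : ℝ) + 1) * alphaRot⌋ : ℝ)| := abs_add_le _ _
    _ ≤ |δ| + 1 * |(⌊t - ((k : ℝ) + 1) * alphaRot⌋ : ℝ)| := by
        rw [abs_mul, abs_of_pos (by linarith : 0 < 1 - β)]
        gcongr; linarith
    _ ≤ _ := by linarith

lemma sumF {β : ℝ} (h0 : 0 < β) (h1 : β < 1) (δ t : ℝ) :
    Summable (fun k : ℕ => β ^ k * (δ + (1 - β) * (⌊t - ((k : ℝ) + 1) * alphaRot⌋ : ℝ))) :=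
  Summable.of_norm_bounded (sum_bound h0 h1 _) (term_bound h0 h1 δ t)

lemma F_add_one {β : ℝ} (h0 : 0 < β) (h1 : β < 1) (δ t : ℝ) : F β δ (t + 1) = F β δ t + 1 := by
  have hg := (hasSum_geometric_of_lt_one h0.le h1).mul_left (1 - β)
  rw [mul_inv_cancel₀ (by linarith)] at hg
  have := (sumF h0 h1 δ t).hasSum.add hg
  refine HasSum.tsum_eq (this.congr_fun ?_)
  intro k
  have : t + 1 - ((k : ℝ) + 1) * alphaRot = t - ((k : ℝ) + 1) * alphaRot + 1 := by ring
  rw [this, Int.floor_add_one]; push_cast; ring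

lemma F_add_alpha {β : ℝ} (h0 : 0 < β) (h1 : β < 1) (δ t : ℝ) : F β δ (t + alphaRot) = β * F β δ t + (1 - β) * ⌊t⌋ + δ := by
  unfold F
  rw [(sumF h0 h1 δ (t + alphaRot)).tsum_eq_zero_add, ← tsum_mul_left]
  have : ∀ k : ℕ, β ^ (k+1) * (δ + (1 - β) *
      (⌊t + alphaRot - (((k+1 : ℕ) : ℝ) + 1) * alphaRot⌋ : ℝ)) =
      β * (β ^ k * (δ + (1 - β) * (⌊t - ((k : ℝ) + 1) * alphaRot⌋ : ℝ))) := by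
    intro k
    have : t + alphaRot - (((k+1 : ℕ) : ℝ) + 1) * alphaRot = t - ((k : ℝ) + 1) * alphaRot := by
      push_cast; ring
    rw [this]; ring
  simp_rw [this]
  simp
  ring

lemma exists_floor (s t : ℝ) (hst : s < t) :
    ∃ k : ℕ, ⌊s - ((k : ℝ) + 1) * alphaRot⌋ < ⌊t - ((k : ℝ) + 1) * alphaRot⌋ := by
  obtain ⟨N, hN⟩ := exists_nat_gt (1 / (t - s))
  have hts : 0 < t - s := by linarith
  have hNpos : 0 < N := by
    have : (0 : ℝ) < N := lt_trans (by positivity) hN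
    exact_mod_cast this
  obtain ⟨n, hn0, -, hn⟩ := Real.exists_nat_abs_mul_sub_round_le alphaRot hNpos
  set m : ℤ := round ((n : ℝ) * alphaRot) with hm
  have hlt : |(n : ℝ) * alphaRot - m| < t - s := by
    refine lt_of_le_of_lt hn ?_
    rw [div_lt_iff₀ (by positivity)]
    rw [div_lt_iff₀ hts] at hN
    nlinarith
  have hne : (n : ℝ) * alphaRot - m ≠ 0 := by
    have := (alpha_irr.natCast_mul (m := n) (by omega)).ne_int m
    exact sub_ne_zero.mpr this
  set ε := (n : ℝ) * alphaRot - m with hε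
  suffices h : ∃ (j : ℕ) (p : ℤ), s - alphaRot - j * ε < p ∧ (p : ℝ) ≤ t - alphaRot - j * ε by
    obtain ⟨j, p, h1, h2⟩ := h
    refine ⟨j * n, ?_⟩
    have e : ∀ x : ℝ, x - (((j * n : ℕ) : ℝ) + 1) * alphaRot =
        x - alphaRot - j * ε - ((j * m : ℤ) : ℝ) := by
      intro x; rw [hε]; push_cast; ring
    rw [e, e, Int.floor_sub_intCast, Int.floor_sub_intCast]
    have := Int.floor_lt.mpr h1
    have := Int.le_floor.mpr h2
    omega
  rcases lt_or_gt_of_ne hne with hneg | hpos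
  · rw [abs_of_neg hneg] at hlt
    have hp := Int.le_ceil (t - alphaRot)
    set p := ⌈t - alphaRot⌉
    have a := Nat.le_ceil ((p - (t - alphaRot)) / (-ε))
    have b := Nat.ceil_lt_add_one (a := (p - (t - alphaRot)) / (-ε))
      (div_nonneg (by linarith) (by linarith))
    refine ⟨⌈(p - (t - alphaRot)) / (-ε)⌉₊, p, ?_, ?_⟩
    · rw [← sub_lt_iff_lt_add, lt_div_iff₀ (by linarith)] at b
      linarith
    · rw [div_le_iff₀ (by linarith)] at a
      linarith
  · rw [abs_of_pos hpos] at hlt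
    have hp := Int.floor_le (s - alphaRot)
    set p := ⌊s - alphaRot⌋
    have a := Nat.lt_floor_add_one ((s - alphaRot - p) / ε)
    have b := Nat.floor_le (a := (s - alphaRot - p) / ε)
      (div_nonneg (by linarith) (by linarith))
    refine ⟨⌊(s - alphaRot - p) / ε⌋₊ + 1, p, ?_, ?_⟩
    · rw [div_lt_iff₀ hpos] at a
      push_cast
      linarith
    · rw [le_div_iff₀ hpos] at b
      push_cast
      linarith

lemma F_strictMono {β : ℝ} (h0 : 0 < β) (h1 : β < 1) (δ : ℝ) : StrictMono (F β δ) := by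
  intro s t hst
  obtain ⟨k, hk⟩ := exists_floor s t hst
  have hb : 0 < 1 - β := by linarith
  refine Summable.tsum_lt_tsum (i := k) ?_ ?_ (sumF h0 h1 δ s) (sumF h0 h1 δ t)
  · intro j
    have : ⌊s - ((j : ℝ) + 1) * alphaRot⌋ ≤ ⌊t - ((j : ℝ) + 1) * alphaRot⌋ :=
      Int.floor_le_floor (by linarith)
    have : (⌊s - ((j : ℝ) + 1) * alphaRot⌋ : ℝ) ≤ ⌊t - ((j : ℝ) + 1) * alphaRot⌋ := by
      exact_mod_cast this
    beta_reduce
    gcongr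
  · have : (⌊s - ((k : ℝ) + 1) * alphaRot⌋ : ℝ) < ⌊t - ((k : ℝ) + 1) * alphaRot⌋ := by
      exact_mod_cast hk
    beta_reduce
    gcongr

lemma F_cont {β : ℝ} (h0 : 0 < β) (h1 : β < 1) (δ : ℝ) : Tendsto (F β δ) (𝓝 0) (𝓝 (F β δ 0)) := by
  unfold F
  refine tendsto_tsum_of_dominated_convergence (sum_bound h0 h1 (|δ| + 1 + 2)) ?_ ?_
  · intro k
    have hne : ∀ z : ℤ, (0 : ℝ) - ((k : ℝ) + 1) * alphaRot ≠ z := by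
      intro z hz
      refine (alpha_irr.natCast_mul (m := k + 1) (by omega)).ne_int (-z) ?_
      push_cast; linarith
    have hc : ContinuousAt (fun t : ℝ => t - ((k : ℝ) + 1) * alphaRot) 0 := by fun_prop
    have h2 : ∀ᶠ t in 𝓝 (0 : ℝ), ⌊t - ((k : ℝ) + 1) * alphaRot⌋
        = ⌊(0 : ℝ) - ((k : ℝ) + 1) * alphaRot⌋ := by
      have hl := Int.floor_le ((0 : ℝ) - ((k : ℝ) + 1) * alphaRot)
      have hl' := lt_of_le_of_ne hl (hne _).symm
      have hr := Int.lt_floor_add_one ((0 : ℝ) - ((k : ℝ) + 1) * alphaRot)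
      filter_upwards [hc.eventually (lt_mem_nhds hl'), hc.eventually (gt_mem_nhds hr)] with t a b
      rw [Int.floor_eq_iff]
      exact ⟨a.le, b⟩
    refine Tendsto.congr' ?_ tendsto_const_nhds
    filter_upwards [h2] with t ht
    rw [ht]
  · filter_upwards [Metric.ball_mem_nhds (0 : ℝ) one_pos] with t ht k
    have ht : |t| < 1 := by simpa using ht
    refine (term_bound h0 h1 δ t k).trans ?_
    have := pow_pos h0 k
    gcongr

lemma F_zero {b : ℝ} (hb : 1 < b) : F (1 / b) (fibDelta b) 0 = 0 := by
  have h0 : 0 < 1 / b := by positivity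
  have h1 : 1 / b < 1 := by rw [div_lt_one] <;> linarith
  unfold F fibDelta
  set β := 1 / b with hβ
  have hfl : ∀ k : ℕ, (⌊0 - ((k : ℝ) + 1) * alphaRot⌋ : ℤ) =
      ⌊((k : ℝ) + 1) * phiGolden⌋ - 2 * (k + 1) := by
    intro k
    have : 0 - ((k : ℝ) + 1) * alphaRot =
        ((k : ℝ) + 1) * phiGolden - ((2 * (k + 1) : ℤ) : ℝ) := by
      unfold alphaRot phiGolden; push_cast; ring
    rw [this, Int.floor_sub_intCast]
  have hs : Summable (fun k : ℕ => β ^ k * (⌊0 - ((k : ℝ) + 1) * alphaRot⌋ : ℝ)) := by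
    refine Summable.of_norm_bounded (sum_bound h0 h1 2) ?_
    intro k
    have := floor_bound 0 k
    rw [norm_mul, Real.norm_eq_abs, Real.norm_eq_abs, abs_of_pos (pow_pos h0 k)]
    apply mul_le_mul_of_nonneg_left _ (pow_pos h0 k).le
    rw [abs_zero] at this
    linarith
  have hshift := hs.tsum_eq_zero_add
  have hs' := (summable_nat_add_iff 1).mpr hs
  have hg := hasSum_geometric_of_lt_one h0.le h1
  have hw : ∑' k : ℕ, (fibWord k : ℝ) * β ^ k =
      (∑' k : ℕ, β ^ k * (⌊0 - ((k : ℝ) + 1) * alphaRot⌋ : ℝ)) -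
      β⁻¹ * ∑' k : ℕ, β ^ (k+1) * (⌊0 - (((k+1 : ℕ) : ℝ) + 1) * alphaRot⌋ : ℝ) := by
    rw [← tsum_mul_left, ← hs.tsum_sub (hs'.mul_left _)]
    congr 1; ext k
    rw [hfl, hfl]
    unfold fibWord
    have e : ((k + 1 : ℕ) : ℝ) + 1 = (k : ℝ) + 2 := by push_cast; ring
    rw [e]
    push_cast
    field_simp
    ring
  have hA : ∑' k : ℕ, β ^ k * ((1 - β + β * (1 - β) * ∑' k : ℕ, (fibWord k : ℝ) * β ^ k) +
      (1 - β) * (⌊0 - ((k : ℝ) + 1) * alphaRot⌋ : ℝ)) =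
      (1 - β + β * (1 - β) * ∑' k : ℕ, (fibWord k : ℝ) * β ^ k) * (1 - β)⁻¹ + (1 - β) *
      ∑' k : ℕ, β ^ k * (⌊0 - ((k : ℝ) + 1) * alphaRot⌋ : ℝ) := by
    generalize (1 - β + β * (1 - β) * ∑' k : ℕ, (fibWord k : ℝ) * β ^ k) = d
    rw [← hg.tsum_eq, ← tsum_mul_left, ← tsum_mul_left,
      ← (hg.summable.mul_left _).tsum_add (hs.mul_left _)]
    congr 1; ext k; ring
  rw [hA, hw]
  have hf0 : (⌊0 - (((0:ℕ) : ℝ) + 1) * alphaRot⌋ : ℤ) = -1 := by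
    have := alpha_pos
    have := alpha_lt
    rw [Int.floor_eq_iff]; push_cast; constructor <;> linarith
  rw [hf0] at hshift
  generalize (∑' k : ℕ, β ^ k * (⌊0 - ((k : ℝ) + 1) * alphaRot⌋ : ℝ)) = A at *
  generalize (∑' k : ℕ, β ^ (k+1) * (⌊0 - (((k+1 : ℕ) : ℝ) + 1) * alphaRot⌋ : ℝ)) = B at *
  have hB : B = A + 1 := by rw [hshift]; push_cast; ring
  rw [hB]
  have : 1 - β ≠ 0 := by linarith
  have : β ≠ 0 := h0.ne'
  clear_value β
  field_simp
  ring

noncomputable def H (β δ x : ℝ) : ℝ := sSup {t | F β δ t ≤ x}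

/-- Main facts in normalized coordinates. -/
theorem core {β δ : ℝ} (h0 : 0 < β) (h1 : β < 1) (hF0 : F β δ 0 = 0) :
    0 ≤ δ ∧ δ < 1 ∧ Continuous (H β δ) ∧ Monotone (H β δ) ∧ H β δ 0 = 0 ∧ H β δ 1 = 1 ∧
    ∀ z, 0 ≤ z → z ≤ 1 → 
      (β * z + δ < 1 → H β δ (β * z + δ) = Trot (H β δ z)) ∧
      (1 ≤ β * z + δ → H β δ (β * z + δ - 1) = Trot (H β δ z)) := by
  have hm := F_strictMono h0 h1 δ
  have hF1 : F β δ 1 = 1 := by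
    have := F_add_one h0 h1 δ 0
    rw [hF0] at this; simpa using this
  have hFn : ∀ n : ℕ, F β δ n = n ∧ F β δ (-n) = -n := by
    intro n
    induction n with
    | zero => simp [hF0]
    | succ n ih =>
      have a := F_add_one h0 h1 δ n
      have b := F_add_one h0 h1 δ (-((n + 1 : ℕ) : ℝ))
      have e : -((n + 1 : ℕ) : ℝ) + 1 = -n := by push_cast; ring
      rw [e, ih.2] at b
      push_cast at *
      constructor <;> linarith [ih.1]
  have hFz : ∀ n : ℤ, F β δ n = n := by
    intro n
    obtain ⟨k, rfl | rfl⟩ := n.eq_nat_or_neg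
    · exact_mod_cast (hFn k).1
    · exact_mod_cast (hFn k).2
  have hfl : ∀ t, ⌊F β δ t⌋ = ⌊t⌋ := by
    intro t
    rw [Int.floor_eq_iff]
    constructor
    · rw [← hFz]; exact hm.monotone (Int.floor_le t)
    · have := hm (Int.lt_floor_add_one t)
      rwa [F_add_one h0 h1, hFz] at this
  let G : ℝ → ℝ := fun x => β * x + (1 - β) * ⌊x⌋ + δ
  have hGm : StrictMono G := by
    intro x y hxy
    have : (⌊x⌋ : ℝ) ≤ ⌊y⌋ := by exact_mod_cast Int.floor_le_floor hxy.le
    have : (1 - β) * (⌊x⌋ : ℝ) ≤ (1 - β) * ⌊y⌋ :=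
      mul_le_mul_of_nonneg_left this (by linarith)
    have := mul_lt_mul_of_pos_left hxy h0
    simp only [G]; linarith
  have hFG : ∀ t, F β δ (t + alphaRot) = G (F β δ t) := by
    intro t; rw [F_add_alpha h0 h1]; simp only [G, hfl]
  have hne : ∀ x, {t | F β δ t ≤ x}.Nonempty := by
    intro x
    exact ⟨(⌊x⌋ : ℤ), by simpa [hFz] using Int.floor_le x⟩
  have hbd : ∀ x, BddAbove {t | F β δ t ≤ x} := by
    intro x
    refine ⟨(⌈x⌉ : ℤ), ?_⟩
    intro t ht
    have : F β δ t ≤ F β δ (⌈x⌉ : ℤ) := by rw [hFz]; exact le_trans ht (Int.le_ceil x)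
    exact hm.le_iff_le.mp this
  have le_H : ∀ t x, F β δ t ≤ x → t ≤ H β δ x := fun t x h => le_csSup (hbd x) h
  have H_le : ∀ t x, x ≤ F β δ t → H β δ x ≤ t := by
    intro t x h
    exact csSup_le (hne x) fun s hs => hm.le_iff_le.mp (le_trans hs h)
  have hHF : ∀ t, H β δ (F β δ t) = t := fun t =>
    le_antisymm (H_le _ _ le_rfl) (le_H _ _ le_rfl)
  have hHm : Monotone (H β δ) := by
    intro x y hxy
    exact csSup_le_csSup (hbd y) (hne x) fun t ht => le_trans ht hxy
  have hHc : Continuous (H β δ) :=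
    hHm.continuous_of_surjective fun t => ⟨_, hHF t⟩
  have hHG : ∀ x, H β δ (G x) = H β δ x + alphaRot := by
    intro x
    apply le_antisymm
    · apply csSup_le (hne _)
      intro t ht
      have : F β δ (t - alphaRot) ≤ x := by
        apply hGm.le_iff_le.mp
        rw [← hFG]; simpa using ht
      linarith [le_H _ _ this]
    · rw [← le_sub_iff_add_le]
      apply csSup_le (hne _)
      intro t ht
      rw [le_sub_iff_add_le]
      apply le_H
      rw [hFG]; exact hGm.monotone ht
  have hH1 : ∀ x, H β δ (x + 1) = H β δ x + 1 := by
    intro x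
    apply le_antisymm
    · apply csSup_le (hne _)
      intro t ht
      have : F β δ (t - 1) ≤ x := by
        have := F_add_one h0 h1 δ (t - 1)
        rw [sub_add_cancel] at this
        have ht : F β δ t ≤ x + 1 := ht
        linarith
      linarith [le_H _ _ this]
    · rw [← le_sub_iff_add_le]
      apply csSup_le (hne _)
      intro t ht
      rw [le_sub_iff_add_le]
      apply le_H
      rw [F_add_one h0 h1]
      have ht : F β δ t ≤ x := ht
      linarith
  have hH0 : H β δ 0 = 0 := by have := hHF 0; rwa [hF0] at this
  have hH11 : H β δ 1 = 1 := by have := hHF 1; rwa [hF1] at this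
  have hFa : F β δ alphaRot = δ := by
    have := hFG 0
    simpa [hF0, G] using this
  have hδ : 0 ≤ δ := by
    rw [← hFa, ← hF0]; exact hm.monotone alpha_pos.le
  have hlt1 : ∀ x, x < 1 → H β δ x < 1 := by
    intro x hx
    have hc := F_cont h0 h1 δ
    rw [hF0] at hc
    have he := hc.eventually (lt_mem_nhds (show x - 1 < 0 by linarith))
    obtain ⟨e, he0, he⟩ := Metric.eventually_nhds_iff.mp he
    have := he (y := -(e/2)) (by rw [Real.dist_eq, sub_zero, abs_neg, abs_of_pos] <;> linarith)
    have h2 := F_add_one h0 h1 δ (-(e/2))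
    have := H_le (-(e/2) + 1) x (by linarith)
    linarith
  have hδ1 : δ < 1 := by
    rw [← hFa, ← hF1]; exact hm alpha_lt
  refine ⟨hδ, hδ1, hHc, hHm, hH0, hH11, ?_⟩
  intro z hz0 hz1
  have hlim : H β δ (β + δ) = 1 + alphaRot := by
    apply le_antisymm
    · rw [← hH11, ← hHG]
      apply hHm
      simp only [G]; rw [Int.floor_one]; push_cast; linarith
    · apply le_of_forall_lt
      intro c hc
      have hc' : max (c - alphaRot) 0 < 1 := by
        apply max_lt <;> linarith
      obtain ⟨s, hs, hs1⟩ := exists_between hc'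
      have hs0 : 0 < s := lt_of_le_of_lt (le_max_right _ _) hs
      have hsc : c - alphaRot < s := lt_of_le_of_lt (le_max_left _ _) hs
      have : s + alphaRot ≤ H β δ (β + δ) := by
        apply le_H
        rw [hFG]
        have h3 : ⌊F β δ s⌋ = 0 := by
          rw [hfl, Int.floor_eq_zero_iff]; exact ⟨hs0.le, hs1⟩
        have h4 : F β δ s ≤ 1 := by rw [← hF1]; exact hm.monotone hs1.le
        simp only [G, h3]
        push_cast
        nlinarith
      linarith
  have hmain : H β δ (β * z + δ) = H β δ z + alphaRot := by
    rcases hz1.lt_or_eq with h | h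
    · have h3 : ⌊z⌋ = 0 := by rw [Int.floor_eq_zero_iff]; exact ⟨hz0, h⟩
      rw [← hHG]; simp [G, h3]
    · rw [h, hH11, mul_one, hlim]
  constructor
  · intro h
    have := hlt1 _ h
    rw [hmain] at this ⊢
    rw [Trot, if_pos (by linarith)]
  · intro h
    have h5 := hHm h
    have h6 := hH1 (β * z + δ - 1)
    rw [sub_add_cancel] at h6
    rw [hH11] at h5
    rw [hmain] at h5 h6
    rw [Trot, if_neg (by linarith)]
    linarith

end S9

theorem stmt9 (b : ℝ) (hb : 1 < b) :
    Set.MapsTo (fmap b) (Kset b) (Kset b) ∧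
    ∃ h : ℝ → ℝ, ContinuousOn h (Kset b) ∧ MonotoneOn h (Kset b) ∧
      Set.MapsTo h (Kset b) (Set.Icc 0 1) ∧
      Set.SurjOn h (Kset b) (Set.Icc 0 1) ∧
      ∀ x ∈ Kset b, h (fmap b x) = Trot (h x) := by
  have h0 : 0 < 1 / b := by positivity
  have h1 : 1 / b < 1 := by rw [div_lt_one] <;> linarith
  obtain ⟨hδ, hδ1, hc, hm, hH0, hH1, hconj⟩ := S9.core h0 h1 (S9.F_zero hb)
  set δ := fibDelta b with hδd
  set L := 500 * b / (b - 1) * (2 - δ) with hL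
  have hb1 : b - 1 ≠ 0 := by linarith
  have hb0 : b ≠ 0 := by linarith
  have hR : 500 * b / (b - 1) * (3 - δ - 1 / b) = L + 500 := by
    rw [hL]; field_simp; ring
  have hK : ∀ x, x ∈ Kset b ↔ 0 ≤ (x - L) / 500 ∧ (x - L) / 500 ≤ 1 := by
    intro x
    unfold Kset
    rw [← hδd, hR, ← hL, Set.mem_Icc]
    constructor <;> rintro ⟨h, h'⟩ <;> constructor <;> linarith
  have hρ : rhoParam b = L + 500 * (b * (1 - δ)) := by
    rw [rhoParam, ← hδd, hL]; field_simp; ring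
  have hcond : ∀ x, x < rhoParam b ↔ 1 / b * ((x - L) / 500) + δ < 1 := by
    intro x
    have : 1 / b * ((x - L) / 500) + δ < 1 ↔ (x - L) / 500 / b < 1 - δ := by
      rw [show 1 / b * ((x - L) / 500) = (x - L) / 500 / b by ring]
      constructor <;> intro <;> linarith
    rw [this, div_lt_iff₀ (by linarith), hρ]
    constructor <;> intro <;> linarith
  have hLb : L / b = L - 1000 + 500 * δ := by
    rw [hL]; field_simp; ring
  have hf1 : ∀ x, x < rhoParam b → (fmap b x - L) / 500 = 1 / b * ((x - L) / 500) + δ := by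
    intro x hx
    rw [fmap, if_pos hx]
    have : 1 / b * ((x - L) / 500) = (x / b - L / b) / 500 := by ring
    rw [this, hLb]; ring
  have hf2 : ∀ x, ¬ x < rhoParam b →
      (fmap b x - L) / 500 = 1 / b * ((x - L) / 500) + δ - 1 := by
    intro x hx
    rw [fmap, if_neg hx]
    have : 1 / b * ((x - L) / 500) = (x / b - L / b) / 500 := by ring
    rw [this, hLb]; ring
  refine ⟨?_, fun x => S9.H (1 / b) δ ((x - L) / 500), ?_, ?_, ?_, ?_, ?_⟩
  · intro x hx
    rw [hK] at hx ⊢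
    by_cases hxr : x < rhoParam b
    · rw [hf1 x hxr]
      have := (hcond x).mp hxr
      have := mul_nonneg h0.le hx.1
      constructor <;> linarith
    · rw [hf2 x hxr]
      have := mt (hcond x).mpr hxr
      have : 1 / b * ((x - L) / 500) ≤ 1 * 1 :=
        mul_le_mul h1.le hx.2 hx.1 zero_le_one
      constructor <;> linarith
  · exact (hc.comp (by fun_prop)).continuousOn
  · intro x _ y _ hxy
    apply hm
    linarith
  · intro x hx
    rw [hK] at hx
    have a := hm hx.1
    have b := hm hx.2
    rw [hH0] at a
    rw [hH1] at b
    exact ⟨a, b⟩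
  · intro t ht
    have := intermediate_value_Icc (zero_le_one (α := ℝ)) hc.continuousOn
    rw [hH0, hH1] at this
    obtain ⟨z, hz, hzt⟩ := this ht
    refine ⟨500 * z + L, ?_, ?_⟩
    · rw [hK]
      rw [show (500 * z + L - L) / 500 = z by ring]
      exact hz
    · simp only
      rw [show (500 * z + L - L) / 500 = z by ring]
      exact hzt
  · intro x hx
    rw [hK] at hx
    simp only
    by_cases hxr : x < rhoParam b
    · rw [hf1 x hxr]
      exact (hconj _ hx.1 hx.2).1 ((hcond x).mp hxr)
    · rw [hf2 x hxr]
      exact (hconj _ hx.1 hx.2).2 (not_lt.mp (mt (hcond x).mpr hxr))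
end

section
/- Let φ = (1+√5)/2 be the golden ratio and α = (3−√5)/2 = 2 − φ. Then for every integer k ≥ 0, the k-th letter of the Fibonacci word coincides with the coding of the orbit of α under the rotation by α: one has 2 + ⌊(k+1)φ⌋ − ⌊(k+2)φ⌋ = 0 if and only if the fractional part of (k+1)α is less than 1 − α, and 2 + ⌊(k+1)φ⌋ − ⌊(k+2)φ⌋ = 1 if and only if the fractional part of (k+1)α is at least 1 − α. -/
open Filter Topology

theorem phi_floor_lt (n : ℕ) (hn : n ≠ 0) : (⌊(n : ℝ) * phiGolden⌋ : ℝ) < (n : ℝ) * phiGolden := by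
  refine lt_of_le_of_ne (Int.floor_le _) ?_
  have h : Irrational ((n : ℝ) * phiGolden) := Real.goldenRatio_irrational.natCast_mul hn
  exact (h.ne_int _).symm

theorem stmt12 (k : ℕ) :
    (fibWord k = 0 ↔ Int.fract (((k : ℝ) + 1) * alphaRot) < 1 - alphaRot) ∧
    (fibWord k = 1 ↔ 1 - alphaRot ≤ Int.fract (((k : ℝ) + 1) * alphaRot)) := by
  have h1 := phi_floor_lt (k + 1) (by omega)
  have h2 := phi_floor_lt (k + 2) (by omega)
  push_cast at h1 h2
  have h3 := Int.lt_floor_add_one (((k : ℝ) + 1) * phiGolden)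
  have h4 := Int.lt_floor_add_one (((k : ℝ) + 2) * phiGolden)
  have hp1 : 1 < phiGolden := Real.one_lt_goldenRatio
  have hp2 : phiGolden < 2 := Real.goldenRatio_lt_two
  have ha : alphaRot = 2 - phiGolden := by unfold alphaRot phiGolden; ring
  unfold fibWord
  rw [ha]
  generalize ⌊((k : ℝ) + 1) * phiGolden⌋ = F at *
  generalize ⌊((k : ℝ) + 2) * phiGolden⌋ = G at *
  have hf : Int.fract (((k : ℝ) + 1) * (2 - phiGolden)) = F + 1 - ((k : ℝ) + 1) * phiGolden := by
    rw [Int.fract_eq_iff]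
    refine ⟨by linarith, by linarith, 2 * (k + 1) - F - 1, ?_⟩
    push_cast
    ring
  rw [hf]
  have hG2 : G < F + 3 := by
    have : (G : ℝ) < F + 3 := by linarith
    exact_mod_cast this
  have hG3 : F < G := by
    by_contra hc
    have hc : (G : ℝ) ≤ F := by exact_mod_cast not_lt.mp hc
    linarith
  have hG : G = F + 1 ∨ G = F + 2 := by omega
  rcases hG with rfl | rfl
  · push_cast at h2 h4
    refine ⟨⟨fun h => by omega, fun h => by linarith⟩, ⟨fun _ => by linarith, fun _ => by ring⟩⟩
  · push_cast at h2 h4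
    refine ⟨⟨fun h => by linarith, fun h => by ring⟩, ⟨fun _ => by omega, fun _ => by linarith⟩⟩
end

section
/- Let b > 1 and δ ∈ (0,1) with b(1−δ) ≤ 1, and let ḡ : ℝ → ℝ be defined by ḡ(x) = x/b + δ if x < b(1−δ) and ḡ(x) = x/b + δ − 1 if x ≥ b(1−δ). Then for every x ∈ ℝ there exists an integer k ≥ 0 such that ḡ^k(x) ∈ [0,1]. -/
open Filter Topology

noncomputable def gbar (b δ : ℝ) (x : ℝ) : ℝ :=
  if x < b * (1 - δ) then x / b + δ else x / b + δ - 1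

theorem stmt13 (b δ : ℝ) (hb : 1 < b) (hδ0 : 0 < δ) (hδ1 : δ < 1)
    (hbd : b * (1 - δ) ≤ 1) :
    ∀ x : ℝ, ∃ k : ℕ, (gbar b δ)^[k] x ∈ Set.Icc (0 : ℝ) 1 := by
  have hb0 : 0 < b := by linarith
  have hbδ : 0 < b * (1 - δ) := mul_pos hb0 (by linarith)
  have up : ∀ n : ℕ, ∀ x : ℝ, 0 ≤ x → x ≤ 1 + n * (1 - δ) →
      ∃ k : ℕ, (gbar b δ)^[k] x ∈ Set.Icc (0 : ℝ) 1 := by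
    intro n
    induction n with
    | zero =>
      intro x h0 h1
      refine ⟨0, h0, ?_⟩
      simpa using h1
    | succ n ih =>
      intro x h0 h1
      by_cases hx : x ≤ 1
      · exact ⟨0, h0, hx⟩
      push Not at hx
      have e : gbar b δ x = x / b + δ - 1 := by
        unfold gbar
        rw [if_neg (by linarith)]
      have l1 : 1 - δ ≤ x / b := by
        rw [le_div_iff₀ hb0]
        nlinarith
      have l2 : x / b ≤ x := div_le_self h0 hb.le
      push_cast at h1
      obtain ⟨k, hk⟩ := ih (gbar b δ x) (by rw [e]; linarith) (by rw [e]; linarith)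
      exact ⟨k + 1, by rw [Function.iterate_succ_apply]; exact hk⟩
  have down : ∀ n : ℕ, ∀ x : ℝ, x ≤ 1 → -(n * δ) ≤ x →
      ∃ k : ℕ, (gbar b δ)^[k] x ∈ Set.Icc (0 : ℝ) 1 := by
    intro n
    induction n with
    | zero =>
      intro x h0 h1
      refine ⟨0, ?_, h0⟩
      simpa using h1
    | succ n ih =>
      intro x h0 h1
      by_cases hx : 0 ≤ x
      · exact ⟨0, hx, h0⟩
      push Not at hx
      have e : gbar b δ x = x / b + δ := by
        unfold gbar
        rw [if_pos (by linarith)]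
      have l1 : x / b ≤ 0 := div_nonpos_of_nonpos_of_nonneg hx.le hb0.le
      have l2 : x ≤ x / b := by
        rw [le_div_iff₀ hb0]
        nlinarith
      push_cast at h1
      obtain ⟨k, hk⟩ := ih (gbar b δ x) (by rw [e]; linarith) (by rw [e]; linarith)
      exact ⟨k + 1, by rw [Function.iterate_succ_apply]; exact hk⟩
  intro x
  rcases le_total 0 x with h | h
  · obtain ⟨n, hn⟩ := exists_nat_ge (x / (1 - δ))
    rw [div_le_iff₀ (by linarith)] at hn
    exact up n x h (by linarith)
  · obtain ⟨n, hn⟩ := exists_nat_ge (-x / δ)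
    rw [div_le_iff₀ hδ0] at hn
    exact down n x (by linarith) (by linarith)
end
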